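/- arXiv:1612.05997 — 3 statements merged into one kernel-verified Lean document; each statement's English description precedes it below -/
import Mathlib

section
/- Let L = F_{2^n}, let k ≥ 2, let t = 2^{2k} − 2^k + 1 be the Kasami–Welch number, and let f(x) = x^t + g(x) ∈ L[x] where deg(g) ≤ 2^{2k−1} − 2^{k−1} + 1 and g(x) = Σ_j a_j x^j. If there exists an index j ≥ 3 with a_j ≠ 0 such that φ_j(x,y,z) is absolutely irreducible, then f is not exceptional APN: there are only finitely many m ≥ 1 such that f is APN on F_{2^{nm}}. -/
/-- `g` is almost perfect nonlinear (APN) on the field `K`: for all `a ≠ 0` and all `b`,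
the equation `g(x+a) + g(x) = b` has at most two solutions. -/
def IsAPN {K : Type} [Field K] (g : K → K) : Prop :=
  ∀ a b : K, a ≠ 0 → {x : K | g (x + a) + g x = b}.ncard ≤ 2

namespace KasamiAPN
open Polynomial

section StepanovBasics
variable {K : Type*} [Field K]

/-- all inner degrees are at most `N` -/
def YD (p : K[X][X]) (N : ℕ) : Prop := ∀ i, (p.coeff i).natDegree ≤ N

lemma YD.mono {p : K[X][X]} {N N' : ℕ} (h : YD p N) (hN : N ≤ N') : YD p N' :=
  fun i => (h i).trans hN

lemma YD.mul {p r : K[X][X]} {N N' : ℕ} (h : YD p N) (h' : YD r N') : YD (p * r) (N + N') := by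
  intro i
  rw [coeff_mul]
  refine natDegree_sum_le_of_forall_le _ _ fun x _ => ?_
  exact natDegree_mul_le.trans (add_le_add (h _) (h' _))

lemma YD.add {p r : K[X][X]} {N : ℕ} (h : YD p N) (h' : YD r N) : YD (p + r) N := by
  intro i
  rw [coeff_add]
  exact (natDegree_add_le _ _).trans (max_le (h _) (h' _))

lemma YD.sub {p r : K[X][X]} {N : ℕ} (h : YD p N) (h' : YD r N) : YD (p - r) N := by
  intro i
  rw [coeff_sub]
  exact (natDegree_sub_le _ _).trans (max_le (h _) (h' _))

lemma YD.sum {ι : Type*} (s : Finset ι) (p : ι → K[X][X]) {N : ℕ} (h : ∀ i ∈ s, YD (p i) N) :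
    YD (∑ i ∈ s, p i) N := by
  intro i
  rw [finsetSum_coeff]
  exact natDegree_sum_le_of_forall_le _ _ fun x hx => h x hx i

lemma YD.C_mul_X_pow (a : K[X]) (n N : ℕ) (h : a.natDegree ≤ N) :
    YD (C a * X ^ n : K[X][X]) N := by
  intro i
  rw [coeff_C_mul, coeff_X_pow]
  split_ifs <;> simp [h]

lemma YD.pow {p : K[X][X]} {N : ℕ} (h : YD p N) (n : ℕ) : YD (p ^ n) (n * N) := by
  induction n with
  | zero => 
    intro i
    rw [pow_zero, coeff_one]
    split_ifs <;> simp
  | succ n ih => rw [pow_succ, Nat.succ_mul]; exact ih.mul h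

lemma YD_modByMonic {ψ : K[X][X]} (hψ : ψ.Monic) (hd : 0 < ψ.natDegree) {c : ℕ} (hc : YD ψ c) :
    ∀ (M : ℕ) (p : K[X][X]) (N : ℕ), p.natDegree < M → YD p N → YD (p %ₘ ψ) (N + c * M) := by
  intro M
  induction M with
  | zero => intro p N h; omega
  | succ M ih =>
    intro p N hM hN
    by_cases hlt : p.natDegree < ψ.natDegree
    · rw [(modByMonic_eq_self_iff hψ).2 (degree_lt_degree hlt)]
      exact hN.mono (by omega)
    · push Not at hlt
      have hp0 : p ≠ 0 := by rintro rfl; simp at hlt; omega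
      set t : K[X][X] := C p.leadingCoeff * X ^ (p.natDegree - ψ.natDegree) with ht
      have h1 : (p - ψ * t) %ₘ ψ = p %ₘ ψ := by
        rw [sub_modByMonic, (modByMonic_eq_zero_iff_dvd hψ).2 (dvd_mul_right _ _), sub_zero]
      have h2 : (p - ψ * t).degree < p.degree :=
        div_wf_lemma ⟨by
          rw [degree_eq_natDegree hp0, degree_eq_natDegree hψ.ne_zero]
          exact_mod_cast hlt, hp0⟩ hψ
      have h3 : (p - ψ * t).natDegree < M := by
        have : (p - ψ * t).natDegree < p.natDegree := by
          by_cases h0 : p - ψ * t = 0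
          · rw [h0]; simp; omega
          · exact natDegree_lt_natDegree h0 h2
        omega
      have h4 : YD (p - ψ * t) (N + c) := by
        refine (hN.mono (by omega)).sub ?_
        rw [add_comm]
        exact hc.mul (YD.C_mul_X_pow _ _ _ (hN _))
      rw [← h1]
      exact (ih _ _ h3 h4).mono (by ring_nf; omega)

lemma resultant_ne_zero_of_irreducible {R : Type*} [CommRing R] [IsDomain R]
    [IsIntegrallyClosed R] {f g : R[X]} (hf : f.Monic) (hirr : Irreducible f) (hfg : ¬ f ∣ g) :
    resultant f g ≠ 0 := by
  intro h0
  let F := FractionRing R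
  have hinj : Function.Injective (algebraMap R F) := IsFractionRing.injective R F
  have h1 : resultant (f.map (algebraMap R F)) (g.map (algebraMap R F)) = 0 := by
    rw [natDegree_map_eq_of_injective hinj, natDegree_map_eq_of_injective hinj,
      resultant_map_map, h0, map_zero]
  rw [resultant_eq_zero_iff] at h1
  apply h1.2
  have hirr' : Irreducible (f.map (algebraMap R F)) :=
    (hf.irreducible_iff_irreducible_map_fraction_map).1 hirr
  refine (hirr'.coprime_iff_not_dvd).2 fun hd => hfg ?_
  exact (map_dvd_map _ hinj hf).1 hd

lemma natDegree_det_le {n : ℕ} (A : Matrix (Fin n) (Fin n) K[X]) (N : ℕ)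
    (h : ∀ i j, (A i j).natDegree ≤ N) : A.det.natDegree ≤ n * N := by
  rw [Matrix.det_apply]
  refine natDegree_sum_le_of_forall_le _ _ fun σ _ => ?_
  have h1 : (∏ i, A (σ i) i).natDegree ≤ n * N := by
    refine (natDegree_prod_le _ _).trans ?_
    refine (Finset.sum_le_card_nsmul _ _ N fun i _ => h _ _).trans ?_
    simp
  rcases Int.units_eq_one_or (Equiv.Perm.sign σ) with hs | hs <;> rw [hs]
  · simpa using h1
  · simpa using h1

lemma exists_bezout {ψ : K[X][X]} (hψ : ψ.Monic) (hirr : Irreducible ψ) {c : ℕ} (hc : YD ψ c)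
    {a : K[X][X]} (ha : a ≠ 0) (had : a.natDegree < ψ.natDegree) {N : ℕ} (hN : YD a N) :
    ∃ (u v : K[X][X]) (r : K[X]), r ≠ 0 ∧ r.natDegree ≤ 2 * ψ.natDegree * (c + N) ∧
      ψ * u + a * v = C r := by
  have hnd : ¬ ψ ∣ a := fun h => absurd (natDegree_le_of_dvd h ha) (by omega)
  obtain ⟨u, v, -, -, h⟩ := exists_mul_add_mul_eq_C_resultant ψ a le_rfl
    le_rfl (Or.inl (by omega))
  refine ⟨u, v, _, resultant_ne_zero_of_irreducible hψ hirr hnd, ?_, h⟩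
  rw [resultant]
  refine (natDegree_det_le _ (c + N) ?_).trans ?_
  · intro i j
    unfold sylvester
    simp only [Matrix.of_apply]
    refine Fin.addCases (fun k => ?_) (fun k => ?_) j
    · simp only [Fin.addCases_left]
      split_ifs
      · exact (hN _).trans (by omega)
      · simp
    · simp only [Fin.addCases_right]
      split_ifs
      · exact (hc _).trans (by omega)
      · simp
  · exact Nat.mul_le_mul (by omega) le_rfl

end StepanovBasics
end KasamiAPN

namespace KasamiAPN
open Polynomial

section Place
variable {K : Type*} [Field K] [IsAlgClosed K]

lemma exists_place {ψ : K[X][X]} (hψ : ψ.Monic) (hirr : Irreducible ψ) (hd : 0 < ψ.natDegree)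
    (hder : derivative ψ ≠ 0) {c : ℕ} (hc : YD ψ c) :
    ∃ ev : K[X][X] →ₐ[K] PowerSeries K, ev ψ = 0 ∧
      ∀ (a : K[X][X]) (N : ℕ), a ≠ 0 → a.natDegree < ψ.natDegree → YD a N →
        (ev a).order ≤ ((2 * ψ.natDegree * (c + N) : ℕ) : ℕ∞) := by
  have hYD' : YD (derivative ψ) c := by
    intro i
    rw [coeff_derivative]
    have : ((i : K[X]) + 1) = C ((i : K) + 1) := by simp
    rw [this]
    exact (natDegree_mul_C_le _ _).trans (hc _)
  obtain ⟨u, v, r, hr0, -, huv⟩ := exists_bezout hψ hirr hc hder (natDegree_derivative_lt hd.ne') hYD'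
  obtain ⟨s, hs⟩ : ∃ s : K, r.eval s ≠ 0 := by
    by_contra! h
    exact hr0 (Polynomial.funext (by simpa using h))
  obtain ⟨x, hx⟩ : ∃ x : K, (ψ.map (evalRingHom s)).eval x = 0 :=
    IsAlgClosed.exists_root _ (by
      rw [hψ.degree_map, degree_eq_natDegree hψ.ne_zero]
      exact_mod_cast hd.ne')
  have hx' : ((derivative ψ).map (evalRingHom s)).eval x ≠ 0 := by
    intro h
    have := congrArg (fun p => eval x (Polynomial.map (evalRingHom s) p)) huv
    simp only [Polynomial.map_add, Polynomial.map_mul, eval_add, eval_mul, hx, h, map_C, eval_C,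
      zero_mul, zero_add] at this
    exact hs this.symm
  -- inner map
  let σ : PowerSeries K := PowerSeries.C s + PowerSeries.X
  let φ : K[X] →ₐ[K] PowerSeries K := aeval σ
  have hφ0 : ∀ p : K[X], PowerSeries.constantCoeff (φ p) = p.eval s := by
    intro p
    have : (PowerSeries.constantCoeff (R := K)).comp (φ : K[X] →+* PowerSeries K) = evalRingHom s := by
      apply Polynomial.ringHom_ext
      · intro a; simp [φ]
      · simp [φ, σ]
    exact congrArg (fun f => f p) this
  have hφ : ∀ p : K[X], p ≠ 0 → (φ p).order ≤ p.natDegree := by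
    intro p hp
    have h1 : φ p = ((taylor s p : K[X]) : PowerSeries K) := by
      have : φ = (Polynomial.coeToPowerSeries.algHom K).comp (taylorAlgHom s) := by
        apply Polynomial.algHom_ext
        simp [φ, σ, Polynomial.coeToPowerSeries.algHom_apply, add_comm]
      rw [this]
      simp [Polynomial.coeToPowerSeries.algHom_apply]
    rw [h1]
    apply PowerSeries.order_le
    rw [Polynomial.coeff_coe, ← natDegree_taylor p s, coeff_natDegree]
    intro h
    rw [leadingCoeff_eq_zero] at h
    exact hp (taylor_injective s (by rw [h]; simp))
  let Ψ : (PowerSeries K)[X] := ψ.map (φ : K[X] →+* PowerSeries K)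
  have hcc : ∀ p : K[X][X], PowerSeries.constantCoeff
      ((p.map (φ : K[X] →+* PowerSeries K)).eval (PowerSeries.C x)) =
      (p.map (evalRingHom s)).eval x := by
    intro p
    have h1 := Polynomial.eval₂_hom (p := p.map (φ : K[X] →+* PowerSeries K))
      (PowerSeries.constantCoeff (R := K)) (PowerSeries.C x)
    rw [← h1, eval₂_map, PowerSeries.constantCoeff_C, eval_map]
    congr 1
    exact RingHom.ext fun p => by simpa using hφ0 p
  have hH : HenselianRing (PowerSeries K) (Ideal.span {PowerSeries.X}) := inferInstance
  obtain ⟨ξ, hξ, -⟩ := hH.is_henselian Ψ (hψ.map _) (PowerSeries.C x)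
    (by
      rw [Ideal.mem_span_singleton, PowerSeries.X_dvd_iff, hcc, hx])
    (by
      apply IsUnit.map
      rw [PowerSeries.isUnit_iff_constantCoeff, derivative_map, hcc]
      exact hx'.isUnit)
  have hev : aevalAeval σ ξ ψ = 0 := by
    have : aevalAeval σ ξ ψ = Ψ.eval ξ := by
      have h : ((aevalAeval σ ξ : K[X][X] →ₐ[K] PowerSeries K) : K[X][X] →+* PowerSeries K) =
          (evalRingHom ξ).comp (mapRingHom (φ : K[X] →+* PowerSeries K)) := by
        apply Polynomial.ringHom_ext
        · intro a; exact (aevalAeval_C σ ξ a).trans (by simp [φ])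
        · simp
      exact congrArg (fun f => f ψ) h
    rw [this]; exact hξ
  refine ⟨aevalAeval σ ξ, hev, ?_⟩
  · intro a N ha had hN
    obtain ⟨u, v, r, hr0, hrd, huv⟩ := exists_bezout hψ hirr hc ha had hN
    have h1 := congrArg (aevalAeval σ ξ) huv
    have hr : aevalAeval σ ξ (C r) = φ r := aevalAeval_C σ ξ r
    rw [map_add, map_mul, map_mul, hev, zero_mul, zero_add, hr] at h1
    refine le_trans ?_ ((hφ r hr0).trans (by exact_mod_cast hrd))
    rw [← h1, PowerSeries.order_mul]
    exact le_self_add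

end Place
end KasamiAPN

namespace KasamiAPN
open Polynomial

section Box
variable {K : Type*} [Field K]

/-- the polynomial with prescribed coefficients on a box -/
noncomputable def box (d L : ℕ) : (Fin d × Fin L → K) →ₗ[K] K[X][X] where
  toFun w := ∑ i : Fin d × Fin L, w i • (C (X ^ (i.2 : ℕ)) * X ^ (i.1 : ℕ))
  map_add' w w' := by simp [add_smul, Finset.sum_add_distrib]
  map_smul' r w := by simp [Finset.smul_sum, mul_smul]

lemma box_apply (d L : ℕ) (w : Fin d × Fin L → K) :
    box d L w = ∑ i : Fin d × Fin L, w i • (C (X ^ (i.2 : ℕ)) * X ^ (i.1 : ℕ)) := rfl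

lemma box_coeff (d L : ℕ) (w : Fin d × Fin L → K) (i : Fin d) :
    (box d L w).coeff i = ∑ l : Fin L, w (i, l) • X ^ (l : ℕ) := by
  rw [box_apply, finsetSum_coeff, Fintype.sum_prod_type, Finset.sum_eq_single i]
  · refine Finset.sum_congr rfl fun l _ => ?_
    rw [coeff_smul, coeff_C_mul, coeff_X_pow]; simp
  · intro b _ hb
    refine Finset.sum_eq_zero fun l _ => ?_
    rw [coeff_smul, coeff_C_mul, coeff_X_pow, if_neg]
    · simp
    · exact fun h => hb (Fin.ext h.symm)
  · simp

lemma box_coeff_coeff (d L : ℕ) (w : Fin d × Fin L → K) (i : Fin d) (l : Fin L) :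
    ((box d L w).coeff i).coeff l = w (i, l) := by
  rw [box_coeff, finsetSum_coeff, Finset.sum_eq_single l]
  · simp [coeff_smul, coeff_X_pow]
  · intro b _ hb
    rw [coeff_smul, coeff_X_pow, if_neg]
    · simp
    · exact fun h => hb (Fin.ext h.symm)
  · simp

lemma box_ne_zero (d L : ℕ) {w : Fin d × Fin L → K} (hw : w ≠ 0) : box d L w ≠ 0 := by
  intro h
  apply hw
  ext ⟨i, l⟩
  rw [← box_coeff_coeff d L w i l, h]; simp

lemma box_YD (d L : ℕ) (w : Fin d × Fin L → K) : YD (box d L w) L := by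
  rw [box_apply]
  refine YD.sum _ _ fun i _ => ?_
  rw [← smul_mul_assoc, smul_C]
  refine YD.C_mul_X_pow _ _ _ ?_
  exact (natDegree_smul_le _ _).trans (by rw [natDegree_X_pow]; exact i.2.2.le)

lemma box_natDegree_lt {d : ℕ} (hd : 0 < d) (L : ℕ) (w : Fin d × Fin L → K) :
    (box d L w).natDegree < d := by
  have : (box d L w).natDegree ≤ d - 1 := by
    rw [box_apply]
    refine natDegree_sum_le_of_forall_le _ _ fun i _ => ?_
    rw [← smul_mul_assoc, smul_C]
    exact (natDegree_C_mul_X_pow_le _ _).trans (by have := i.1.2; omega)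
  omega

lemma exists_orders {d L : ℕ} (hd : 0 < d) (ev : K[X][X] →ₐ[K] PowerSeries K) (B : ℕ)
    (h : ∀ a : K[X][X], a ≠ 0 → a.natDegree < d → YD a L → (ev a).order ≤ (B : ℕ∞)) :
    ∃ (S : Finset ℕ) (e : ℕ → Fin d × Fin L → K), d * L ≤ S.card ∧
      ∀ σ ∈ S, (ev (box d L (e σ))).order = (σ : ℕ∞) := by
  classical
  let S : Finset ℕ := (Finset.range (B + 1)).filter
    fun σ => ∃ w : Fin d × Fin L → K, (ev (box d L w)).order = (σ : ℕ∞)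
  have hS : ∀ σ ∈ S, ∃ w : Fin d × Fin L → K, (ev (box d L w)).order = (σ : ℕ∞) := by
    intro σ hσ
    exact (Finset.mem_filter.1 hσ).2
  choose! e he using hS
  refine ⟨S, e, ?_, he⟩
  let T : (Fin d × Fin L → K) →ₗ[K] (S → K) :=
    LinearMap.pi fun σ => (PowerSeries.coeff (σ : ℕ)).comp (ev.toLinearMap.comp (box d L))
  have hT : Function.Injective T := by
    rw [injective_iff_map_eq_zero]
    intro w hw
    by_contra hw0
    have h1 := h _ (box_ne_zero d L hw0) (box_natDegree_lt hd L w) (box_YD d L w)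
    obtain ⟨σ, hσ⟩ : ∃ σ : ℕ, (ev (box d L w)).order = σ :=
      ⟨_, (ENat.natCast_toNat (ne_top_of_le_ne_top (ENat.natCast_ne_top B) h1)).symm⟩
    have hσS : σ ∈ S := by
      refine Finset.mem_filter.2 ⟨?_, w, hσ⟩
      rw [hσ] at h1
      have : σ ≤ B := by exact_mod_cast h1
      simp; omega
    have h2 : PowerSeries.coeff σ (ev (box d L w)) = 0 := congrFun hw ⟨σ, hσS⟩
    have h3 := PowerSeries.coeff_order (φ := ev (box d L w)) (by intro h0; rw [h0, PowerSeries.order_zero] at hσ; exact absurd hσ.symm (ENat.natCast_ne_top σ))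
    rw [hσ] at h3
    exact h3 (by simpa using h2)
  have := LinearMap.finrank_le_finrank_of_injective hT
  simpa using this

/-- Linear algebra: killing many polynomials modulo `ψ`. -/
lemma exists_combination {ψ : K[X][X]} (hψ : ψ.Monic) (hd : 0 < ψ.natDegree) {c : ℕ} (hc : YD ψ c)
    {α J : Type*} [Fintype α] [Fintype J] (g : α → J → K[X][X]) (M N : ℕ)
    (hM : ∀ a j, (g a j).natDegree < M) (hN : ∀ a j, YD (g a j) N)
    (hcard : Fintype.card J * (ψ.natDegree * (N + c * M + 1)) < Fintype.card α) :
    ∃ Z : α → K, Z ≠ 0 ∧ ∀ j, ψ ∣ ∑ a, Z a • g a j := by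
  classical
  let D := N + c * M + 1
  let T : (α → K) →ₗ[K] (J × (Fin ψ.natDegree × Fin D) → K) :=
    LinearMap.pi fun jil => ∑ a, (((g a jil.1 %ₘ ψ).coeff jil.2.1).coeff jil.2.2) • LinearMap.proj a
  have hk : LinearMap.ker T ≠ ⊥ := by
    apply LinearMap.ker_ne_bot_of_finrank_lt
    simpa [D] using hcard
  obtain ⟨Z, hZ, hZ0⟩ := Submodule.exists_mem_ne_zero_of_ne_bot hk
  refine ⟨Z, hZ0, fun j => ?_⟩
  rw [← modByMonic_eq_zero_iff_dvd hψ]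
  have hsum : (∑ a, Z a • g a j) %ₘ ψ = ∑ a, Z a • (g a j %ₘ ψ) := by
    have h1 := map_sum ((modByMonicHom ψ).restrictScalars K) (fun a => Z a • g a j) Finset.univ
    simp only [map_smul] at h1
    exact h1
  rw [hsum]
  ext i l
  rw [finsetSum_coeff, finsetSum_coeff]
  simp only [coeff_zero]
  by_cases hi : i < ψ.natDegree
  · by_cases hl : l < D
    · have := congrFun (LinearMap.mem_ker.1 hZ) (j, ⟨i, hi⟩, ⟨l, hl⟩)
      simp only [T, LinearMap.pi_apply, LinearMap.sum_apply, LinearMap.smul_apply,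
        LinearMap.proj_apply, smul_eq_mul, Pi.zero_apply] at this
      rw [← this]
      refine Finset.sum_congr rfl fun a _ => ?_
      simp [coeff_smul, mul_comm]
    · refine Finset.sum_eq_zero fun a _ => ?_
      rw [coeff_smul, coeff_smul, coeff_eq_zero_of_natDegree_lt, smul_zero]
      have := YD_modByMonic hψ hd hc M (g a j) N (hM a j) (hN a j) i
      omega
  · refine Finset.sum_eq_zero fun a _ => ?_
    rw [coeff_smul, coeff_eq_zero_of_natDegree_lt (n := i), smul_zero, coeff_zero]
    have := natDegree_modByMonic_lt (g a j) hψ (by rintro rfl; simp at hd)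
    omega

end Box
end KasamiAPN

namespace KasamiAPN
open Polynomial

section Points
variable {K : Type*} [Field K]

/-- twisted coefficient polynomials -/
noncomputable def tw {d L : ℕ} (q : ℕ) (w : Fin d × Fin L → K) (i : Fin d) : K[X] :=
  ∑ l : Fin L, C (w (i, l) ^ q) * X ^ (l : ℕ)

lemma tw_natDegree {d L : ℕ} (q : ℕ) (w : Fin d × Fin L → K) (i : Fin d) :
    (tw q w i).natDegree ≤ L := by
  refine natDegree_sum_le_of_forall_le _ _ fun l _ => ?_
  exact (natDegree_C_mul_X_pow_le _ _).trans l.2.le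

lemma evalEval_box (d L : ℕ) (w : Fin d × Fin L → K) (s x : K) :
    evalEval s x (box d L w) = ∑ i : Fin d, ∑ l : Fin L, w (i, l) * (s ^ (l : ℕ) * x ^ (i : ℕ)) := by
  rw [box_apply, ← Fintype.sum_prod_type' (f := fun (i : Fin d) (l : Fin L) =>
    w (i, l) * (s ^ (l : ℕ) * x ^ (i : ℕ)))]
  simp only [evalEval, eval_finsetSum, eval_smul, eval_mul, eval_C, eval_pow, eval_X, smul_eq_mul]

lemma evalEval_box_pow [CharP K 2] (d L : ℕ) (w : Fin d × Fin L → K) (s x : K) (n : ℕ)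
    (hs : s ^ 2 ^ n = s) :
    (evalEval s x (box d L w)) ^ 2 ^ n =
      ∑ i : Fin d, (x ^ 2 ^ n) ^ (i : ℕ) * eval s (tw (2 ^ n) w i) := by
  rw [evalEval_box, ← iterateFrobenius_def (R := K) 2 n]
  simp only [map_sum, map_mul, map_pow]
  simp only [iterateFrobenius_def, hs]
  refine Finset.sum_congr rfl fun i _ => ?_
  rw [tw, eval_finsetSum, Finset.mul_sum]
  refine Finset.sum_congr rfl fun l _ => ?_
  simp only [eval_mul, eval_C, eval_pow, eval_X]
  ring

/-- Horner remainders -/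
noncomputable def hor (ψ : K[X][X]) (j : ℕ) : K[X][X] := divX^[j] ψ

lemma hor_coeff (ψ : K[X][X]) (j n : ℕ) : (hor ψ j).coeff n = ψ.coeff (n + j) := by
  induction j generalizing n with
  | zero => rfl
  | succ j ih =>
    have : hor ψ (j + 1) = divX (hor ψ j) := Function.iterate_succ_apply' _ _ _
    rw [this, coeff_divX, ih]
    congr 1; ring

lemma hor_YD {ψ : K[X][X]} {c : ℕ} (h : YD ψ c) (j : ℕ) : YD (hor ψ j) c := by
  intro i; rw [hor_coeff]; exact h _

lemma hor_natDegree (ψ : K[X][X]) (j : ℕ) : (hor ψ j).natDegree ≤ ψ.natDegree - j := by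
  rw [natDegree_le_iff_coeff_eq_zero]
  intro n hn
  rw [hor_coeff]
  exact coeff_eq_zero_of_natDegree_lt (by omega)

lemma hor_natDegree_eq (ψ : K[X][X]) (hψ : ψ.Monic) : hor ψ ψ.natDegree = 1 := by
  have h := hor_natDegree ψ ψ.natDegree
  rw [Nat.sub_self] at h
  rw [eq_C_of_natDegree_le_zero h, hor_coeff, zero_add, hψ.coeff_natDegree, C_1]

lemma hor_sum (ψ : K[X][X]) (hψ : ψ.Monic) (s x y : K) (hx : evalEval s x ψ = 0)
    (hy : evalEval s y ψ = 0) (hxy : y ≠ x) :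
    ∑ j ∈ Finset.range ψ.natDegree, y ^ j * evalEval s x (hor ψ (j + 1)) = 0 := by
  have hrec : ∀ j, evalEval s x (hor ψ j) =
      evalEval s x (hor ψ (j + 1)) * x + eval s (ψ.coeff j) := by
    intro j
    have h1 : hor ψ (j + 1) = divX (hor ψ j) := Function.iterate_succ_apply' _ _ _
    have h2 := divX_mul_X_add (hor ψ j)
    rw [hor_coeff, zero_add, ← h1] at h2
    rw [← h2]
    simp [evalEval]
  have key : ∀ n, (y - x) * ∑ j ∈ Finset.range n, y ^ j * evalEval s x (hor ψ (j + 1)) =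
      y ^ n * evalEval s x (hor ψ n) + ∑ j ∈ Finset.range n, eval s (ψ.coeff j) * y ^ j := by
    intro n
    induction n with
    | zero => simpa [hor] using hx.symm
    | succ n ih =>
      rw [Finset.sum_range_succ, mul_add, ih, Finset.sum_range_succ, hrec n]
      ring
  have h3 := key ψ.natDegree
  rw [hor_natDegree_eq ψ hψ] at h3
  have h4 : evalEval s y ψ = ∑ j ∈ Finset.range (ψ.natDegree + 1), eval s (ψ.coeff j) * y ^ j := by
    rw [evalEval, eval_eq_sum_range (p := ψ), eval_finsetSum]
    simp only [eval_mul, eval_pow, eval_C]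
  rw [Finset.sum_range_succ, hψ.coeff_natDegree, hy] at h4
  have h5 : (y - x) * ∑ j ∈ Finset.range ψ.natDegree, y ^ j * evalEval s x (hor ψ (j + 1)) = 0 := by
    rw [h3, h4]; simp [evalEval]; ring
  rcases mul_eq_zero.1 h5 with h | h
  · exact absurd (sub_eq_zero.1 h) hxy
  · exact h

/-- sum of power series with separated orders is nonzero -/
lemma sum_ne_zero_of_orders {ι : Type*} (S : Finset ι) (w : ι → ℕ) (hw : Function.Injective w)
    (A D : ι → PowerSeries K) (q' : ℕ)
    (hD : ∀ σ ∈ S, (D σ).order = (w σ : ℕ∞))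
    (hA : ∀ σ ∈ S, A σ = 0 ∨ (A σ).order < (q' : ℕ∞)) (hne : ∃ σ ∈ S, A σ ≠ 0) :
    ∑ σ ∈ S, A σ * D σ ^ q' ≠ 0 := by
  classical
  let T := S.filter fun σ => A σ ≠ 0
  obtain ⟨σ₀, hσ₀, hmin⟩ := Finset.exists_min_image T w
    (by obtain ⟨σ, h, h'⟩ := hne; exact ⟨σ, Finset.mem_filter.2 ⟨h, h'⟩⟩)
  rw [Finset.mem_filter] at hσ₀
  obtain ⟨hσS, hA0⟩ := hσ₀
  have hlt := (hA σ₀ hσS).resolve_left hA0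
  obtain ⟨o, ho⟩ : ∃ o : ℕ, (A σ₀).order = o :=
    ⟨_, (ENat.natCast_toNat (ne_top_of_lt hlt)).symm⟩
  rw [ho] at hlt
  have hlt' : o < q' := by exact_mod_cast hlt
  have hord : (A σ₀ * D σ₀ ^ q').order = ((o + q' * w σ₀ : ℕ) : ℕ∞) := by
    rw [PowerSeries.order_mul, PowerSeries.order_pow, ho, hD σ₀ hσS]
    push_cast; simp
  intro h0
  have h1 := congrArg (PowerSeries.coeff (o + q' * w σ₀)) h0
  rw [map_sum, map_zero, Finset.sum_eq_single σ₀] at h1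
  · have h3 := PowerSeries.coeff_order (φ := A σ₀ * D σ₀ ^ q') (by
      intro h0; rw [h0, PowerSeries.order_zero] at hord; exact absurd hord.symm (ENat.natCast_ne_top _))
    rw [hord, ENat.toNat_natCast] at h3
    exact h3 h1
  · intro σ hσ hne
    by_cases hA1 : A σ = 0
    · simp [hA1]
    · apply PowerSeries.coeff_of_lt_order
      rw [PowerSeries.order_mul, PowerSeries.order_pow, hD σ hσ]
      have h4 : w σ₀ < w σ := lt_of_le_of_ne (hmin σ (Finset.mem_filter.2 ⟨hσ, hA1⟩))
        fun h => hne (hw h.symm)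
      have h5 : o + q' * w σ₀ < q' * w σ := by nlinarith
      refine lt_of_lt_of_le (b := ((q' * w σ : ℕ) : ℕ∞)) (by exact_mod_cast h5) ?_
      simp
  · exact fun h => absurd hσS h

lemma card_fixed [IsAlgClosed K] [CharP K 2] (n : ℕ) (hn : n ≠ 0) :
    ∃ F : Finset K, F.card = 2 ^ n ∧ ∀ x, x ∈ F ↔ x ^ 2 ^ n = x := by
  classical
  have h1 : 1 < 2 ^ n := Nat.one_lt_two_pow hn
  have hsep := galois_poly_separable (K := K) 2 (2 ^ n) (dvd_pow_self 2 hn)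
  have hdeg : (X ^ 2 ^ n - X : K[X]).natDegree = 2 ^ n := FiniteField.X_pow_card_sub_X_natDegree_eq K h1
  have hne : (X ^ 2 ^ n - X : K[X]) ≠ 0 := FiniteField.X_pow_card_sub_X_ne_zero K h1
  refine ⟨(X ^ 2 ^ n - X : K[X]).roots.toFinset, ?_, ?_⟩
  · rw [Multiset.toFinset_card_of_nodup (nodup_roots hsep), 
      ← (IsAlgClosed.splits (X ^ 2 ^ n - X : K[X])).natDegree_eq_card_roots, hdeg]
  · intro x
    rw [Multiset.mem_toFinset, mem_roots hne, IsRoot.def]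
    simp [sub_eq_zero]

end Points
end KasamiAPN

namespace KasamiAPN
open Polynomial

section Points
variable {K : Type*} [Field K] [IsAlgClosed K] [CharP K 2]

lemma stepanov_core {ψ : K[X][X]} (hψ : ψ.Monic) (hirr : Irreducible ψ) (hd : 0 < ψ.natDegree)
    (hder : derivative ψ ≠ 0) {c : ℕ} (hc : YD ψ c) (d : ℕ) (hdd : ψ.natDegree = d)
    (μ ν B L : ℕ) (G : Finset K)
    (hG : ∀ s ∈ G, s ^ 2 ^ (ν + μ) = s)
    (hGsep : ∀ s ∈ G, (ψ.map (evalRingHom s)).Separable)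
    (hGno : ∀ s ∈ G, ∀ x, evalEval s x ψ = 0 →
      evalEval s (x ^ 2 ^ (ν + μ)) ψ = 0 ∧ x ^ 2 ^ (ν + μ) ≠ x)
    (hcard : (d - 1) * (d * ((2 ^ μ * B + (L + c)) + c * ((2 ^ μ + 1) * d) + 1)) < d * L * (d * B))
    (hq : 2 * d * (c + B) < 2 ^ ν)
    (hGc : B + 2 ^ ν * L + c * (d * (1 + 2 ^ ν)) < G.card) : False := by
  classical
  subst hdd
  set d := ψ.natDegree with hddef
  obtain ⟨ev, hev, hord⟩ := exists_place hψ hirr hd hder hc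
  obtain ⟨S, e, hS, he⟩ := exists_orders (L := L) hd ev _ (fun a h1 h2 h3 => hord a L h1 h2 h3)
  let last : Fin d := ⟨d - 1, by omega⟩
  let emb : Fin (d - 1) → Fin d := fun j => ⟨j, by omega⟩
  let mon : Fin d × Fin B → K[X][X] := fun il => (C (X ^ (il.2 : ℕ)) * X ^ (il.1 : ℕ)) ^ 2 ^ μ
  let g : (S × (Fin d × Fin B)) → Fin (d - 1) → K[X][X] := fun a j =>
    mon a.2 * (C (tw (2 ^ (ν + μ)) (e a.1) (emb j)) -
      hor ψ (j + 1) * C (tw (2 ^ (ν + μ)) (e a.1) last))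
  obtain ⟨Z, hZ0, hZ⟩ := exists_combination hψ hd hc g ((2 ^ μ + 1) * d) (2 ^ μ * B + (L + c))
    (by
      intro a j
      have h1 : (mon a.2).natDegree ≤ 2 ^ μ * (d - 1) := by
        refine natDegree_pow_le.trans (Nat.mul_le_mul le_rfl ?_)
        exact (natDegree_C_mul_X_pow_le _ _).trans (by have := a.2.1.2; omega)
      have h2 : (C (tw (2 ^ (ν + μ)) (e a.1) (emb j)) -
          hor ψ (j + 1) * C (tw (2 ^ (ν + μ)) (e a.1) last)).natDegree ≤ d - 1 := by
        refine (natDegree_sub_le _ _).trans (max_le (by simp) ?_)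
        refine (natDegree_mul_C_le _ _).trans ((hor_natDegree _ _).trans ?_)
        omega
      have h3 : (g a j).natDegree ≤ 2 ^ μ * (d - 1) + (d - 1) := natDegree_mul_le_of_le h1 h2
      have h4 : 2 ^ μ * (d - 1) ≤ 2 ^ μ * d := Nat.mul_le_mul le_rfl (by omega)
      rw [Nat.add_mul]; omega)
    (by
      intro a j
      refine YD.mul ?_ ?_
      · exact YD.pow (YD.C_mul_X_pow _ _ _ (by rw [natDegree_X_pow]; exact a.2.2.2.le)) _
      · have hC : ∀ i, YD (C (tw (2 ^ (ν + μ)) (e a.1) i)) L := by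
          intro i
          have := YD.C_mul_X_pow (tw (2 ^ (ν + μ)) (e a.1) i) 0 L (tw_natDegree _ _ _)
          simpa using this
        refine YD.sub ((hC _).mono (by omega)) ?_
        exact ((hor_YD hc _).mul (hC _)).mono (by omega))
    (by
      simp only [Fintype.card_fin, Fintype.card_prod, Fintype.card_coe]
      refine lt_of_lt_of_le hcard ?_
      exact Nat.mul_le_mul hS le_rfl)
  -- take roots
  have hroot : ∀ a, ∃ z : K, z ^ 2 ^ μ = Z a := fun a =>
    IsAlgClosed.exists_pow_nat_eq _ (by positivity)
  choose z hz using hroot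
  let A : S → K[X][X] := fun σ => box d B fun il => z (σ, il)
  let H : K[X][X] := ∑ σ : S, A σ * (box d L (e σ)) ^ 2 ^ ν
  -- H vanishes at all points over G
  have hvan : ∀ s ∈ G, ∀ x, evalEval s x ψ = 0 → evalEval s x H = 0 := by
    intro s hs x hx
    obtain ⟨hx1, hne⟩ := hGno s hs x hx
    set y := x ^ 2 ^ (ν + μ) with hy
    let E : Fin d → K := fun j => ∑ a : S × (Fin d × Fin B),
      Z a * (evalEval s x (mon a.2) * eval s (tw (2 ^ (ν + μ)) (e a.1) j))
    have hE : ∀ j : Fin (d - 1), E (emb j) = evalEval s x (hor ψ (j + 1)) * E last := by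
      intro j
      obtain ⟨k, hk⟩ := hZ j
      have h1 := congrArg (evalEval s x) hk
      rw [evalEval_mul, hx, zero_mul] at h1
      have h2 : evalEval s x (∑ a, Z a • g a j) =
          E (emb j) - evalEval s x (hor ψ (j + 1)) * E last := by
        simp only [E, Finset.mul_sum]
        rw [← Finset.sum_sub_distrib]
        rw [← coe_evalEvalRingHom, map_sum]
        refine Finset.sum_congr rfl fun a _ => ?_
        rw [coe_evalEvalRingHom]
        have : Z a • g a j = C (C (Z a)) * g a j := by
          ext; simp [coeff_smul]
        rw [this]
        simp only [g, evalEval_mul, evalEval_sub, evalEval_C, eval_C]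
        ring
      rw [h2] at h1
      exact sub_eq_zero.1 h1
    have hE' : ∀ j : Fin d, E j = evalEval s x (hor ψ (j + 1)) * E last := by
      intro j
      by_cases hj : (j : ℕ) < d - 1
      · exact hE ⟨j, hj⟩
      · have : j = last := Fin.ext (by have := j.2; simp only [last]; omega)
        rw [this]
        have h2 : (last : ℕ) + 1 = ψ.natDegree := by simp only [last]; omega
        rw [h2, hor_natDegree_eq ψ hψ]
        simp
    have hP : (evalEval s x H) ^ 2 ^ μ = ∑ j : Fin d, y ^ (j : ℕ) * E j := by
      have h1 : evalEval s x H =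
          ∑ σ : S, evalEval s x (A σ) * (evalEval s x (box d L (e σ))) ^ 2 ^ ν := by
        simp only [H]
        rw [← coe_evalEvalRingHom, map_sum]
        simp only [map_mul, map_pow]
      rw [h1, ← iterateFrobenius_def (R := K) 2 μ, map_sum]
      simp only [E, Finset.mul_sum]
      rw [Finset.sum_comm, Fintype.sum_prod_type]
      refine Finset.sum_congr rfl fun σ _ => ?_
      have hfr : iterateFrobenius K 2 μ (evalEval s x (box d L (e σ)) ^ 2 ^ ν) =
          evalEval s x (box d L (e σ)) ^ 2 ^ (ν + μ) := by
        rw [iterateFrobenius_def, ← pow_mul, ← pow_add]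
      rw [map_mul, hfr,
        evalEval_box_pow d L (e σ) s x (ν + μ) (hG s hs), Finset.mul_sum, Finset.sum_comm]
      refine Finset.sum_congr rfl fun j _ => ?_
      simp only [A]
      rw [evalEval_box, ← Fintype.sum_prod_type' (f := fun (i : Fin d) (l : Fin B) =>
        z (σ, i, l) * (s ^ (l : ℕ) * x ^ (i : ℕ))), map_sum, Finset.sum_mul]
      refine Finset.sum_congr rfl fun il _ => ?_
      rw [map_mul, iterateFrobenius_def, hz]
      simp only [iterateFrobenius_def, mon, evalEval_mul, evalEval_pow, evalEval_C, evalEval_X,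
        eval_pow, eval_X]
      ring
    have hsum : ∑ j : Fin d, y ^ (j : ℕ) * E j = 0 := by
      have h1 := hor_sum ψ hψ s x y hx hx1 hne
      rw [← Fin.sum_univ_eq_sum_range (fun j => y ^ j * evalEval s x (hor ψ (j + 1)))] at h1
      calc _ = (∑ j : Fin d, y ^ (j : ℕ) * evalEval s x (hor ψ (j + 1))) * E last := by
            rw [Finset.sum_mul]
            refine Finset.sum_congr rfl fun j _ => ?_
            rw [hE' j]; ring
        _ = 0 := by rw [h1, zero_mul]
    rw [hsum] at hP
    exact pow_eq_zero_iff (by positivity) |>.1 hP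
  -- H reduces to zero
  have hHdeg : H.natDegree < d * (1 + 2 ^ ν) := by
    have : H.natDegree ≤ (d - 1) + 2 ^ ν * (d - 1) := by
      refine natDegree_sum_le_of_forall_le _ _ fun σ _ => ?_
      refine natDegree_mul_le_of_le ?_ (natDegree_pow_le.trans (Nat.mul_le_mul le_rfl ?_))
      · have := box_natDegree_lt hd B (fun il => z (σ, il)); simp only [A]; omega
      · have := box_natDegree_lt hd L (e σ); omega
    have h4 : 2 ^ ν * (d - 1) ≤ 2 ^ ν * d := Nat.mul_le_mul le_rfl (by omega)
    have h5 : d * (1 + 2 ^ ν) = d + 2 ^ ν * d := by ring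
    omega
  have hHYD : YD H (B + 2 ^ ν * L) := by
    refine YD.sum _ _ fun σ _ => ?_
    exact (box_YD _ _ _).mul ((box_YD _ _ _).pow _)
  have hmod : H %ₘ ψ = 0 := by
    ext1 i
    rw [coeff_zero]
    apply eq_zero_of_natDegree_lt_card_of_eval_eq_zero' _ G
    · intro s hs
      set p := ψ.map (evalRingHom s) with hp
      have hpm : p.Monic := hψ.map _
      have hpd : p.natDegree = d := hψ.natDegree_map _
      have hz : (H %ₘ ψ).map (evalRingHom s) = 0 := by
        apply eq_zero_of_natDegree_lt_card_of_eval_eq_zero' _ p.roots.toFinset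
        · intro x hx
          rw [Multiset.mem_toFinset, mem_roots hpm.ne_zero, IsRoot.def] at hx
          rw [hp, map_evalRingHom_eval] at hx
          rw [map_evalRingHom_eval]
          have h1 := congrArg (evalEval s x) (modByMonic_add_div H ψ)
          rw [evalEval_add, evalEval_mul, hx, zero_mul, add_zero, hvan s hs x hx] at h1
          exact h1
        · rw [Multiset.toFinset_card_of_nodup (nodup_roots (hGsep s hs)),
            ← (IsAlgClosed.splits p).natDegree_eq_card_roots, hpd]
          exact lt_of_le_of_lt natDegree_map_le
            (natDegree_modByMonic_lt H hψ (by rintro h; rw [hddef, h] at hd; simp at hd))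
      have := congrArg (fun r => r.coeff i) hz
      simpa using this
    · refine lt_of_le_of_lt ?_ hGc
      exact YD_modByMonic hψ hd hc _ H _ hHdeg hHYD i
  have hevH : ev H = 0 := by
    have h1 := modByMonic_add_div H ψ
    rw [hmod, zero_add] at h1
    rw [← h1, map_mul, hev, zero_mul]
  have hevH' : ev H = ∑ σ : S, ev (A σ) * (ev (box d L (e σ))) ^ 2 ^ ν := by
    simp only [H, map_sum, map_mul, map_pow]
  rw [hevH'] at hevH
  have hAord : ∀ σ : S, (fun il => z (σ, il)) ≠ 0 → (ev (A σ)).order < ((2 ^ ν : ℕ) : ℕ∞) := by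
    intro σ hσ
    refine lt_of_le_of_lt (hord (A σ) B (box_ne_zero _ _ hσ) (box_natDegree_lt hd _ _)
      (box_YD _ _ _)) ?_
    exact_mod_cast hq
  refine sum_ne_zero_of_orders (Finset.univ : Finset S) (fun σ => (σ : ℕ))
    Subtype.val_injective (fun σ => ev (A σ)) (fun σ => ev (box d L (e σ))) (2 ^ ν)
    (fun σ _ => he σ σ.2) ?_ ?_ hevH
  · intro σ _
    by_cases h : (fun il => z (σ, il)) = 0
    · left
      simp only [A, h, map_zero]
    · right; exact hAord σ h
  · obtain ⟨⟨σ, il⟩, ha⟩ := Function.ne_iff.1 hZ0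
    refine ⟨σ, Finset.mem_univ _, fun h0 => ?_⟩
    have := hAord σ (fun h => ha (by
      rw [← hz, congrFun h il]; simp))
    rw [h0, PowerSeries.order_zero] at this
    exact absurd this (by simp)

end Points
end KasamiAPN

namespace KasamiAPN
open Polynomial

section Points
variable {K : Type*} [Field K] [IsAlgClosed K] [CharP K 2]

lemma arith_bound (d c P : ℕ) (hd : 0 < d) (hP : 2 * d * (c * d + 1) ≤ P) (B : ℕ)
    (hB : B = 2 * d * (2 + 2 * c + 2 * (c * d)) + 1) :
    (d - 1) * (d * ((P * B + ((P - (c * d + 1)) + c)) + c * ((P + 1) * d) + 1)) <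
      d * (P - (c * d + 1)) * (d * B) := by
  have hE : c * d + 1 ≤ P := by nlinarith
  obtain ⟨L, rfl⟩ := Nat.exists_eq_add_of_le hE
  obtain ⟨d', rfl⟩ : ∃ d', d = d' + 1 := ⟨d - 1, by omega⟩
  simp only [Nat.add_sub_cancel, Nat.add_sub_cancel_left]
  set E := c * (d' + 1) + 1 with hEdef
  set P := E + L with hPdef
  have hPpos : 0 < P := by omega
  have key : d' * (P * B + (L + c) + c * ((P + 1) * (d' + 1)) + 1) < (d' + 1) * L * B := by
    have h1 : (d' + 1) * L * B + (d' + 1) * E * B = d' * (P * B) + P * B := by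
      rw [hPdef]; ring
    have h2 : 2 * ((d' + 1) * E * B) ≤ P * B := by
      calc _ = (2 * (d' + 1) * E) * B := by ring
        _ ≤ _ := Nat.mul_le_mul hP le_rfl
    have h3 : 2 * ((d' + 1) * (P * (2 + 2 * c + 2 * (c * (d' + 1))))) < P * B := by
      rw [hB]; ring_nf; nlinarith
    have h4 : d' * ((L + c) + c * ((P + 1) * (d' + 1)) + 1) ≤
        (d' + 1) * (P * (2 + 2 * c + 2 * (c * (d' + 1)))) := by
      refine Nat.mul_le_mul (by omega) ?_
      have h5 : c ≤ P * c := Nat.le_mul_of_pos_left _ hPpos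
      have h6 : c * (d' + 1) ≤ P * (c * (d' + 1)) := Nat.le_mul_of_pos_left _ hPpos
      have h7 : c * ((P + 1) * (d' + 1)) = P * (c * (d' + 1)) + c * (d' + 1) := by ring
      have h8 : P * (2 + 2 * c + 2 * (c * (d' + 1))) =
        2 * P + 2 * (P * c) + 2 * (P * (c * (d' + 1))) := by ring
      rw [h7, h8]
      omega
    have h9 : d' * (P * B + (L + c) + c * ((P + 1) * (d' + 1)) + 1) =
      d' * (P * B) + d' * ((L + c) + c * ((P + 1) * (d' + 1)) + 1) := by ring
    rw [h9]
    omega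
  calc _ = (d' + 1) * (d' * (P * B + (L + c) + c * ((P + 1) * (d' + 1)) + 1)) := by ring
    _ < (d' + 1) * ((d' + 1) * L * B) := Nat.mul_lt_mul_of_pos_left key (by omega)
    _ = _ := by ring

lemma evalEval_frob {K : Type*} [Field K] [CharP K 2] {ψ : K[X][X]} {n : ℕ}
    (hfix : ∀ i j, ((ψ.coeff i).coeff j) ^ 2 ^ n = (ψ.coeff i).coeff j) {s x : K}
    (hs : s ^ 2 ^ n = s) : evalEval s (x ^ 2 ^ n) ψ = (evalEval s x ψ) ^ 2 ^ n := by
  have h1 : ψ.map (mapRingHom (iterateFrobenius K 2 n)) = ψ := by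
    ext i j
    simp [coeff_map, iterateFrobenius_def, hfix]
  have h2 := map_mapRingHom_evalEval (f := iterateFrobenius K 2 n) (x := s) (y := x) (p := ψ)
  rw [h1, iterateFrobenius_def, iterateFrobenius_def, iterateFrobenius_def, hs] at h2
  exact h2

theorem exists_points (d c M : ℕ) (hd : 0 < d) : ∃ N0 : ℕ, ∀ N ≥ N0, ∀ ψ : K[X][X],
    ψ.Monic → ψ.natDegree = d → Irreducible ψ → derivative ψ ≠ 0 → YD ψ c →
    (∀ i j, ((ψ.coeff i).coeff j) ^ 2 ^ N = (ψ.coeff i).coeff j) →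
    ∀ Bad : Finset K, Bad.card ≤ M →
    ∃ s x, s ∉ Bad ∧ s ^ 2 ^ N = s ∧ x ^ 2 ^ N = x ∧ evalEval s x ψ = 0 := by
  classical
  set μ := 2 * d * (c * d + 1) with hμ
  set B := 2 * d * (2 + 2 * c + 2 * (c * d)) + 1 with hB
  set P := 2 ^ μ with hP
  set M' := M + 2 * d * (c + c) with hM'
  set ν0 := B + c * d + M' + 2 * d * (c + B) + 1 with hν0
  refine ⟨ν0 + μ, fun N hN ψ hψ hψd hirr hder hc hfix Bad hBad => ?_⟩
  obtain ⟨ν, rfl⟩ : ∃ ν, N = ν + μ := ⟨N - μ, by omega⟩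
  have hν : ν0 ≤ ν := by omega
  have hν2 : ν < 2 ^ ν := Nat.lt_two_pow_self
  have hPμ : μ ≤ P := Nat.lt_two_pow_self.le
  by_contra hcon
  push Not at hcon
  have hYD' : YD (derivative ψ) c := by
    intro i
    rw [coeff_derivative]
    have : ((i : K[X]) + 1) = C ((i : K) + 1) := by simp
    rw [this]
    exact (natDegree_mul_C_le _ _).trans (hc _)
  obtain ⟨u, v, r, hr0, hrd, huv⟩ := exists_bezout hψ hirr hc hder
    (natDegree_derivative_lt (by omega)) hYD'
  obtain ⟨F, hFc, hF⟩ := card_fixed (K := K) (ν + μ) (by omega)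
  let G := F \ (Bad ∪ r.roots.toFinset)
  have hGmem : ∀ s ∈ G, s ^ 2 ^ (ν + μ) = s ∧ s ∉ Bad ∧ eval s r ≠ 0 := by
    intro s hs
    simp only [G, Finset.mem_sdiff, Finset.mem_union, Multiset.mem_toFinset, mem_roots hr0,
      IsRoot.def, not_or, hF] at hs
    exact hs
  have hGc : 2 ^ ν * P ≤ G.card + M' := by
    have h1 := Finset.le_card_sdiff (Bad ∪ r.roots.toFinset) F
    have h2 := Finset.card_union_le Bad r.roots.toFinset
    have h3 : r.roots.toFinset.card ≤ 2 * d * (c + c) :=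
      (Multiset.toFinset_card_le _).trans ((card_roots' r).trans (hψd ▸ hrd))
    rw [hFc, pow_add, ← hP] at h1
    simp only [G]
    omega
  refine stepanov_core hψ hirr (by omega) hder hc d hψd μ ν B (P - (c * d + 1)) G
    (fun s hs => (hGmem s hs).1) ?_ ?_ (arith_bound d c P hd hPμ B hB) (by omega) ?_
  · intro s hs
    have h1 := congrArg (map (evalRingHom s)) huv
    rw [Polynomial.map_add, Polynomial.map_mul, Polynomial.map_mul, map_C, ← derivative_map] at h1
    have h2 : eval s r ≠ 0 := (hGmem s hs).2.2
    refine ⟨C (eval s r)⁻¹ * u.map (evalRingHom s), C (eval s r)⁻¹ * v.map (evalRingHom s), ?_⟩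
    calc _ = C (eval s r)⁻¹ * (map (evalRingHom s) ψ * map (evalRingHom s) u +
          derivative (map (evalRingHom s) ψ) * map (evalRingHom s) v) := by ring
      _ = 1 := by rw [h1, ← C_mul, coe_evalRingHom, inv_mul_cancel₀ h2, C_1]
  · intro s hs x hx
    obtain ⟨h1, h2, h3⟩ := hGmem s hs
    constructor
    · rw [evalEval_frob hfix h1, hx]; simp
    · intro h
      exact hcon s x h2 h1 h hx
  · have hE : c * d + 1 ≤ P := by nlinarith
    obtain ⟨L, hL⟩ := Nat.exists_eq_add_of_le hE
    rw [hL] at hGc ⊢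
    rw [Nat.add_sub_cancel_left]
    have h1 : 2 ^ ν * (c * d + 1 + L) = c * (d * 2 ^ ν) + 2 ^ ν + 2 ^ ν * L := by ring
    have h2 : c * (d * (1 + 2 ^ ν)) = c * d + c * (d * 2 ^ ν) := by ring
    rw [h1] at hGc
    rw [h2]
    omega

end Points
end KasamiAPN

namespace KasamiAPN
open Polynomial

section Phi

/-- The quotient `φ_j(x,y,z)`, defined by its linear recursion (characteristic two). -/
def Phi {R : Type*} [CommRing R] (x y z : R) : ℕ → R
  | 0 => 0
  | 1 => 0
  | 2 => 0
  | 3 => 1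
  | (j + 4) => (x ^ 2 + y ^ 2 + z ^ 2 + x * y + x * z + y * z) * Phi x y z (j + 2) +
      (x + y) * (x + z) * (y + z) * Phi x y z (j + 1) + x * y * z * (x + y + z) * Phi x y z j

lemma Phi_map {R S : Type*} [CommRing R] [CommRing S] (f : R →+* S) (x y z : R) (j : ℕ) :
    f (Phi x y z j) = Phi (f x) (f y) (f z) j := by
  induction j using Nat.strong_induction_on with
  | _ j ih =>
    match j with
    | 0 => simp [Phi]
    | 1 => simp [Phi]
    | 2 => simp [Phi]
    | 3 => simp [Phi]
    | j + 4 =>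
      rw [Phi, Phi]
      simp only [map_add, map_mul, map_pow]
      rw [ih (j + 2) (by omega), ih (j + 1) (by omega), ih j (by omega)]

lemma Phi_mul {R : Type*} [CommRing R] (h2 : (2 : R) = 0) (x y z : R) (j : ℕ) :
    (x + y) * (x + z) * (y + z) * Phi x y z j = x ^ j + y ^ j + z ^ j + (x + y + z) ^ j := by
  have hx : x ^ 4 = (x ^ 2 + y ^ 2 + z ^ 2 + x * y + x * z + y * z) * x ^ 2 +
    (x + y) * (x + z) * (y + z) * x + x * y * z * (x + y + z) := by
    linear_combination ((-1)*x^3*y^1 + (-1)*x^3*z^1 + (-1)*x^2*y^2 + (-2)*x^2*y^1*z^1 + (-1)*x^2*z^2 + (-1)*x^1*y^2*z^1 + (-1)*x^1*y^1*z^2) * h2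
  have hy : y ^ 4 = (x ^ 2 + y ^ 2 + z ^ 2 + x * y + x * z + y * z) * y ^ 2 +
    (x + y) * (x + z) * (y + z) * y + x * y * z * (x + y + z) := by
    linear_combination ((-1)*x^2*y^2 + (-1)*x^2*y^1*z^1 + (-1)*x^1*y^3 + (-2)*x^1*y^2*z^1 + (-1)*x^1*y^1*z^2 + (-1)*y^3*z^1 + (-1)*y^2*z^2) * h2
  have hz : z ^ 4 = (x ^ 2 + y ^ 2 + z ^ 2 + x * y + x * z + y * z) * z ^ 2 +
    (x + y) * (x + z) * (y + z) * z + x * y * z * (x + y + z) := by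
    linear_combination ((-1)*x^2*y^1*z^1 + (-1)*x^2*z^2 + (-1)*x^1*y^2*z^1 + (-2)*x^1*y^1*z^2 + (-1)*x^1*z^3 + (-1)*y^2*z^2 + (-1)*y^1*z^3) * h2
  have hw : (x + y + z) ^ 4 = (x ^ 2 + y ^ 2 + z ^ 2 + x * y + x * z + y * z) * (x + y + z) ^ 2 +
    (x + y) * (x + z) * (y + z) * (x + y + z) + x * y * z * (x + y + z) := by
    ring
  induction j using Nat.strong_induction_on with
  | _ j ih =>
    match j with
    | 0 => simp only [Phi]; linear_combination (-2) * h2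
    | 1 => simp only [Phi]; linear_combination (-x - y - z) * h2
    | 2 => simp only [Phi]; linear_combination (-x ^ 2 - y ^ 2 - z ^ 2 - x * y - x * z - y * z) * h2
    | 3 => simp only [Phi]; linear_combination ((-1)*x^3 + (-1)*x^2*y^1 + (-1)*x^2*z^1 + (-1)*x^1*y^2 + (-2)*x^1*y^1*z^1 + (-1)*x^1*z^2 + (-1)*y^3 + (-1)*y^2*z^1 + (-1)*y^1*z^2 + (-1)*z^3) * h2
    | j + 4 =>
      have i0 := ih j (by omega)
      have i1 := ih (j + 1) (by omega)
      have i2 := ih (j + 2) (by omega)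
      rw [Phi]
      linear_combination (x ^ 2 + y ^ 2 + z ^ 2 + x * y + x * z + y * z) * i2 +
        (x + y) * (x + z) * (y + z) * i1 + x * y * z * (x + y + z) * i0 - x ^ j * hx - y ^ j * hy -
        z ^ j * hz - (x + y + z) ^ j * hw

lemma Phi_degree {R : Type*} [CommRing R] (b c : R) (j : ℕ) :
    ∀ n, j < n + 3 → (Phi (X : R[X]) (C b) (C c) j).coeff n = 0 := by
  have e2 : (X ^ 2 + C b ^ 2 + C c ^ 2 + X * C b + X * C c + C b * C c : R[X]).natDegree ≤ 2 := by
    compute_degree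
  have e3 : ((X + C b) * (X + C c) * (C b + C c) : R[X]).natDegree ≤ 2 := by
    compute_degree
  have e4 : (X * C b * C c * (X + C b + C c) : R[X]).natDegree ≤ 2 := by
    compute_degree
  have aux : ∀ (e p : R[X]) (m : ℕ), e.natDegree ≤ 2 → (∀ n, m < n + 3 → p.coeff n = 0) →
      ∀ n, m + 2 < n + 3 → (e * p).coeff n = 0 := by
    intro e p m he hp n hn
    rw [coeff_mul]
    refine Finset.sum_eq_zero fun x hx => ?_
    rw [Finset.HasAntidiagonal.mem_antidiagonal] at hx
    by_cases h : 2 < x.1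
    · rw [coeff_eq_zero_of_natDegree_lt (by omega), zero_mul]
    · rw [hp x.2 (by omega), mul_zero]
  induction j using Nat.strong_induction_on with
  | _ j ih =>
    match j with
    | 0 => simp [Phi]
    | 1 => simp [Phi]
    | 2 => simp [Phi]
    | 3 =>
      intro n hn
      simp only [Phi]
      rw [coeff_one, if_neg (by omega)]
    | j + 4 =>
      intro n hn
      rw [Phi, coeff_add, coeff_add, aux _ _ (j + 2) e2 (ih _ (by omega)) n (by omega),
        aux _ _ (j + 1) e3 (ih _ (by omega)) n (by omega),
        aux _ _ j e4 (ih _ (by omega)) n (by omega)]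
      simp

lemma Phi_top {R : Type*} [CommRing R] (b c : R) (i : ℕ) :
    (Phi (X : R[X]) (C b) (C c) (2 * i + 3)).coeff (2 * i) = 1 ∧
    ∀ n, 2 * i ≤ n → (Phi (X : R[X]) (C b) (C c) (2 * i + 2)).coeff n = 0 := by
  have e2 : (X ^ 2 + C b ^ 2 + C c ^ 2 + X * C b + X * C c + C b * C c : R[X]).natDegree ≤ 2 := by
    compute_degree
  have e2' : (X ^ 2 + C b ^ 2 + C c ^ 2 + X * C b + X * C c + C b * C c : R[X]).coeff 2 = 1 := by
    compute_degree <;> norm_num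
  have e3 : ((X + C b) * (X + C c) * (C b + C c) : R[X]).natDegree ≤ 2 := by
    compute_degree
  have e4 : (X * C b * C c * (X + C b + C c) : R[X]).natDegree ≤ 2 := by
    compute_degree
  have aux : ∀ (e p : R[X]) (m : ℕ), e.natDegree ≤ 2 → (∀ n, m ≤ n → p.coeff n = 0) →
      ∀ n, m + 2 ≤ n → (e * p).coeff n = 0 := by
    intro e p m he hp n hn
    rw [coeff_mul]
    refine Finset.sum_eq_zero fun x hx => ?_
    rw [Finset.HasAntidiagonal.mem_antidiagonal] at hx
    by_cases h : 2 < x.1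
    · rw [coeff_eq_zero_of_natDegree_lt (by omega), zero_mul]
    · rw [hp x.2 (by omega), mul_zero]
  induction i with
  | zero => simp [Phi]
  | succ i ih =>
    have hdeg : ∀ j m, j < m + 3 → ∀ n, m ≤ n → (Phi (X : R[X]) (C b) (C c) j).coeff n = 0 :=
      fun j m hjm n hn => Phi_degree b c j n (by omega)
    constructor
    · rw [show 2 * (i + 1) + 3 = (2 * i + 1) + 4 by ring, Phi, coeff_add, coeff_add,
        aux _ _ (2 * i) e3 ih.2 _ (by omega), aux _ _ (2 * i) e4 (hdeg _ _ (by omega)) _ (by omega)]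
      rw [show 2 * (i + 1) = 2 + 2 * i by ring]
      rw [coeff_mul_add_eq_of_natDegree_le e2 (natDegree_le_iff_coeff_eq_zero.2
        fun n hn => Phi_degree b c _ n (by omega)), e2', ih.1]
      simp
    · intro n hn
      rw [show 2 * (i + 1) + 2 = (2 * i) + 4 by ring, Phi, coeff_add, coeff_add,
        aux _ _ (2 * i) e2 ih.2 _ (by omega), aux _ _ (2 * i) e3 (hdeg _ _ (by omega)) _ (by omega),
        aux _ _ (2 * i) e4 (hdeg _ _ (by omega)) _ (by omega)]
      simp

lemma Phi_monic {R : Type*} [CommRing R] [Nontrivial R] (b c : R) (j : ℕ) (h3 : 3 ≤ j)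
    (hj : Odd j) : (Phi (X : R[X]) (C b) (C c) j).Monic ∧
      (Phi (X : R[X]) (C b) (C c) j).natDegree = j - 3 := by
  obtain ⟨i, rfl⟩ : ∃ i, j = 2 * i + 3 := by
    obtain ⟨k, rfl⟩ := hj
    exact ⟨k - 1, by omega⟩
  have h1 : (Phi (X : R[X]) (C b) (C c) (2 * i + 3)).natDegree ≤ 2 * i :=
    natDegree_le_iff_coeff_eq_zero.2 fun n hn => Phi_degree b c _ n (by omega)
  have h2 := (Phi_top b c i).1
  refine ⟨monic_of_natDegree_le_of_coeff_eq_one _ h1 h2, ?_⟩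
  exact le_antisymm h1 (le_natDegree_of_ne_zero (by rw [Nat.add_sub_cancel, h2]; exact one_ne_zero))

end Phi
end KasamiAPN

namespace KasamiAPN
open Polynomial

section NotDvd
variable {K : Type*} [Field K] [CharP K 2]

lemma two_eq_zero' (R : Type*) [CommRing R] [CharP R 2] : (2 : R) = 0 := by
  exact_mod_cast CharP.cast_eq_zero R 2

lemma line_id (j : ℕ) : (X ^ 2 + X) * Phi (X : K[X]) (C 0) (C 1) j = X ^ j + 0 ^ j + 1 + (X + 1) ^ j := by
  have h := Phi_mul (two_eq_zero' K[X]) (X : K[X]) (C 0) (C 1) j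
  simp only [C_0, C_1, add_zero, zero_add, one_pow, mul_one] at h ⊢
  rw [← h]; ring

lemma line_root_ne (j : ℕ) (h3 : 3 ≤ j) (hj : Odd j) {α : K}
    (hα : eval α (Phi (X : K[X]) (C 0) (C 1) j) = 0) : α ≠ 0 ∧ α + 1 ≠ 0 := by
  have h1 := congrArg (fun p => eval α (derivative p)) (line_id (K := K) j)
  have h2 : (2 : K) = 0 := two_eq_zero' K
  have hjK : (j : K) = 1 := by
    obtain ⟨i, rfl⟩ := hj
    push_cast; rw [h2]; ring
  have h0 : (0 : K[X]) ^ j = 0 := zero_pow (by omega)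
  simp only [h0, derivative_mul, eval_add, eval_mul, hα, derivative_add, derivative_X,
    derivative_one, eval_pow, eval_X, eval_C, eval_one, mul_zero, zero_add, add_zero,
    derivative_pow, mul_one, hjK, one_mul, map_natCast, eval_natCast] at h1
  have hj1 : j - 1 ≠ 0 := by omega
  constructor
  · rintro rfl
    simp [hj1] at h1
  · intro h
    rw [h] at h1
    have : α ^ 2 + α = 0 := by linear_combination α * h
    rw [this] at h1
    simp only [zero_mul, zero_pow hj1, add_zero] at h1
    have h4 := pow_eq_zero_iff hj1 |>.1 h1.symm
    rw [h4] at h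
    simp at h

lemma kasami_id (k t : ℕ) (ht : t = 2 ^ (2 * k) - 2 ^ k + 1) :
    (X ^ 2 + X : K[X]) ^ 2 ^ k * (X ^ t + 1 + (X + 1) ^ t) = (X ^ 2 ^ k + X) ^ (2 ^ k + 1) := by
  have h2 : (2 : K[X]) = 0 := two_eq_zero' K[X]
  have hle : 2 ^ k ≤ 2 ^ (2 * k) := Nat.pow_le_pow_right (by norm_num) (by omega)
  have ht' : t + 2 ^ k = 2 ^ (2 * k) + 1 := by omega
  have e1 : (X ^ 2 + X : K[X]) ^ 2 ^ k * (X ^ t + 1 + (X + 1) ^ t) =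
      (X + 1) ^ 2 ^ k * X ^ (t + 2 ^ k) + (X ^ 2 + X) ^ 2 ^ k + X ^ 2 ^ k * (X + 1) ^ (t + 2 ^ k) := by
    have : (X ^ 2 + X : K[X]) = X * (X + 1) := by ring
    rw [this, mul_pow]; ring
  have hk2 : 2 ^ (2 * k) = 2 ^ k * 2 ^ k := by rw [two_mul, pow_add]
  rw [e1, ht', pow_succ _ (2 ^ (2 * k)), pow_succ _ (2 ^ (2 * k)), pow_succ _ (2 ^ k),
    add_pow_char_pow, add_pow_char_pow, add_pow_char_pow, add_pow_char_pow, hk2, one_pow, one_pow,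
    pow_mul]
  generalize hU : (X ^ 2 ^ k : K[X]) = U
  have : (X ^ 2 : K[X]) ^ 2 ^ k = U ^ 2 := by rw [← hU]; ring
  rw [this]
  generalize U ^ 2 ^ k = V
  linear_combination (V * U * X + U) * h2

lemma sq_add_dvd (k : ℕ) : (X ^ 2 + X : K[X]) ∣ X ^ 2 ^ k + X := by
  have h2 : (2 : K[X]) = 0 := two_eq_zero' K[X]
  induction k with
  | zero => 
    have : (X ^ 2 ^ 0 + X : K[X]) = 0 := by
      simp only [pow_zero, pow_one]; linear_combination X * h2
    rw [this]; exact dvd_zero _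
  | succ k ih =>
    have : (X ^ 2 ^ (k + 1) + X : K[X]) = (X ^ 2 ^ k + X) * (X ^ 2 ^ k + X) + (X ^ 2 + X) := by
      rw [pow_succ, pow_mul]
      linear_combination (- X ^ 2 ^ k * X - X ^ 2) * h2
    rw [this]
    exact dvd_add (ih.mul_right _) dvd_rfl

variable [IsAlgClosed K]

lemma line_contra (k t j : ℕ) (hk : 2 ≤ k) (ht : t = 2 ^ (2 * k) - 2 ^ k + 1) (h5 : 5 ≤ j)
    (hj : Odd j) (hjt : j < t) (w : K[X]) (hw : Phi (X : K[X]) (C 0) (C 1) t =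
      Phi (X : K[X]) (C 0) (C 1) j * w) (hcop : IsCoprime (Phi (X : K[X]) (C 0) (C 1) j) w) :
    False := by
  set p := Phi (X : K[X]) (C 0) (C 1) j with hp
  obtain ⟨u, hu⟩ := sq_add_dvd (K := K) k
  have hX : (X ^ 2 + X : K[X]) ≠ 0 := by
    intro h
    have := congrArg (fun r => coeff r 1) h
    simp [coeff_X_pow] at this
  have hpt : p * w = u ^ (2 ^ k + 1) := by
    have h1 := kasami_id (K := K) k t ht
    have h2 := line_id (K := K) t
    rw [zero_pow (by omega), add_zero] at h2
    rw [← h2, hu, mul_pow, ← mul_assoc, ← pow_succ] at h1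
    rw [← hw]
    exact mul_left_cancel₀ (pow_ne_zero _ hX) h1
  obtain ⟨v, hv⟩ := exists_associated_pow_of_mul_eq_pow' hcop hpt
  obtain ⟨hmon, hdeg⟩ := Phi_monic (0 : K) 1 j (by omega) hj
  rw [← hp] at hmon hdeg
  have hdv : (2 ^ k + 1) * v.natDegree = j - 3 := by
    rw [← hdeg, ← natDegree_pow]
    exact natDegree_eq_of_degree_eq (degree_eq_degree_of_associated hv)
  have hvdeg : v.natDegree ≠ 0 := by
    intro h; rw [h] at hdv; omega
  obtain ⟨α, hα⟩ := IsAlgClosed.exists_root v (by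
    intro h; exact hvdeg (natDegree_eq_of_degree_eq_some h))
  have hαp : (X - C α) ^ (2 ^ k + 1) ∣ p :=
    (pow_dvd_pow_of_dvd (dvd_iff_isRoot.2 hα) _).trans hv.dvd
  have hα0 : eval α p = 0 := dvd_iff_isRoot.1 ((dvd_pow_self _ (Nat.succ_ne_zero _)).trans hαp)
  obtain ⟨hne0, hne1⟩ := line_root_ne j (by omega) hj hα0
  -- multiplicity
  have hder : (X - C α) ^ 2 ^ k ∣ (X ^ (j - 1) + (X + 1) ^ (j - 1) : K[X]) := by
    have h1 : (X - C α) ^ (2 ^ k + 1) ∣ (X ^ j + 1 + (X + 1) ^ j : K[X]) := by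
      have h2 := line_id (K := K) j
      rw [zero_pow (by omega), add_zero] at h2
      rw [← h2]; exact hαp.mul_left _
    have h3 : (X - C α) ^ 2 ^ k ∣ derivative (X ^ j + 1 + (X + 1) ^ j : K[X]) := by
      obtain ⟨m, hm⟩ := h1
      rw [hm, derivative_mul, pow_succ, derivative_mul]
      refine dvd_add (Dvd.dvd.mul_right (dvd_add ?_ (dvd_mul_right _ _)) _) ?_
      · have : derivative ((X - C α) ^ 2 ^ k) = 0 := by
          rw [derivative_pow]
          have : ((2 ^ k : ℕ) : K) = 0 := by
            push_cast; rw [two_eq_zero' K, zero_pow (by omega)]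
          rw [this]; simp
        rw [this]; simp
      · exact (dvd_mul_right _ _).mul_right _
    have hjK : (j : K) = 1 := by
      obtain ⟨i, rfl⟩ := hj
      push_cast; rw [two_eq_zero' K]; ring
    have h4 : derivative (X ^ j + 1 + (X + 1) ^ j : K[X]) = X ^ (j - 1) + (X + 1) ^ (j - 1) := by
      simp [derivative_pow, hjK]
    rwa [h4] at h3
  have hq : 2 ^ k ∣ j - 1 := by
    obtain ⟨e, r, hr, her⟩ := Nat.exists_eq_two_pow_mul_odd (n := j - 1) (by omega)
    by_contra hnd
    have hek : e < k := by
      by_contra h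
      push Not at h
      exact hnd (her ▸ (pow_dvd_pow 2 h).mul_right r)
    have h1 : (X ^ (j - 1) + (X + 1) ^ (j - 1) : K[X]) = (X ^ r + (X + 1) ^ r) ^ 2 ^ e := by
      rw [add_pow_char_pow, her, ← pow_mul, ← pow_mul, mul_comm]
    have h2 : ((X - C α) ^ 2) ^ 2 ^ e ∣ (X ^ r + (X + 1) ^ r : K[X]) ^ 2 ^ e := by
      rw [← h1, ← pow_mul, ← pow_succ']
      exact (pow_dvd_pow _ (Nat.pow_le_pow_right (by norm_num) hek)).trans hder
    have h3 : (X - C α) ^ 2 ∣ (X ^ r + (X + 1) ^ r : K[X]) :=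
      (IsIntegrallyClosed.pow_dvd_pow_iff (by positivity)).1 h2
    obtain ⟨m, hm⟩ := h3
    have h4 := congrArg (eval α) hm
    have h5 := congrArg (fun p => eval α (derivative p)) hm
    have hrK : (r : K) = 1 := by
      obtain ⟨i, rfl⟩ := hr
      push_cast; rw [two_eq_zero' K]; ring
    simp [derivative_pow, hrK] at h4 h5
    have hr1 : r = (r - 1) + 1 := by have := hr.pos; omega
    rw [hr1, pow_succ, pow_succ] at h4
    have h6 : α ^ (r - 1) = 0 := by
      linear_combination (α + 1) * h5 - h4
    exact hne0 (eq_zero_of_pow_eq_zero h6)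
  have hk4 : 4 ≤ 2 ^ k := by
    calc 4 = 2 ^ 2 := by norm_num
      _ ≤ 2 ^ k := Nat.pow_le_pow_right (by norm_num) hk
  have hk2 : 2 ^ (2 * k) = 2 ^ k * 2 ^ k := by rw [two_mul, pow_add]
  rw [hk2] at ht
  generalize 2 ^ k = q at *
  have h7 : j - 1 = q * v.natDegree + (v.natDegree + 2) := by
    have : (q + 1) * v.natDegree = q * v.natDegree + v.natDegree := by ring
    omega
  rw [h7] at hq
  have h8 : q ∣ v.natDegree + 2 := (Nat.dvd_add_right (dvd_mul_right q _)).1 hq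
  have h9 : q ≤ v.natDegree + 2 := Nat.le_of_dvd (by omega) h8
  have h10 : q * q ≤ q * (v.natDegree + 2) := Nat.mul_le_mul le_rfl h9
  have h11 : q * (v.natDegree + 2) = q * v.natDegree + 2 * q := by ring
  omega

lemma Phi_not_dvd (k t j : ℕ) (hk : 2 ≤ k) (ht : t = 2 ^ (2 * k) - 2 ^ k + 1) (h5 : 5 ≤ j)
    (hj : Odd j) (hjt : j < t) :
    ¬ Phi (X : (MvPolynomial (Fin 2) K)[X]) (C (MvPolynomial.X 0)) (C (MvPolynomial.X 1)) j ∣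
      Phi (X : (MvPolynomial (Fin 2) K)[X]) (C (MvPolynomial.X 0)) (C (MvPolynomial.X 1)) t := by
  rintro ⟨W, hW⟩
  have htodd : Odd t := by
    have h1 : 2 ^ k ≤ 2 ^ (2 * k) := Nat.pow_le_pow_right (by norm_num) (by omega)
    have h2 : Even (2 ^ (2 * k) - 2 ^ k) := by
      rw [Nat.even_sub h1]
      simp [Nat.even_pow]
    rw [ht]; exact h2.add_one
  -- specialise to the plane z = 1
  let θ : MvPolynomial (Fin 2) K →+* K[X] := (MvPolynomial.aeval ![(X : K[X]), 1]).toRingHom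
  let θ0 : MvPolynomial (Fin 2) K →+* K := (evalRingHom 0).comp θ
  have hθ0 : θ (MvPolynomial.X 0) = X := by simp [θ]
  have hθ1 : θ (MvPolynomial.X 1) = 1 := by simp [θ]
  have h0 := congrArg (mapRingHom θ0) hW
  rw [map_mul, Phi_map, Phi_map] at h0
  simp only [coe_mapRingHom, map_X, map_C, θ0, RingHom.comp_apply, hθ0, hθ1, coe_evalRingHom,
    eval_X, eval_one] at h0
  refine line_contra k t j hk ht h5 hj hjt _ h0 ?_
  rw [isCoprime_iff_aeval_ne_zero_of_isAlgClosed K K]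
  intro α
  by_contra hcon
  push Not at hcon
  obtain ⟨hα, hwα⟩ := hcon
  rw [coe_aeval_eq_eval] at hα hwα
  obtain ⟨-, hne1⟩ := line_root_ne j (by omega) hj hα
  -- specialise x = α
  let η : (MvPolynomial (Fin 2) K)[X] →+* K[X] := eval₂RingHom θ (C α)
  have h1 := congrArg η hW
  rw [map_mul, Phi_map, Phi_map] at h1
  simp only [η, coe_eval₂RingHom, eval₂_X, eval₂_C, hθ0, hθ1] at h1
  have hroot1 : X ∣ Phi (C α) (X : K[X]) 1 j := by
    rw [X_dvd_iff, coeff_zero_eq_eval_zero, ← coe_evalRingHom, Phi_map]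
    rw [← coe_evalRingHom, Phi_map] at hα
    simpa using hα
  have hroot2 : X ∣ eval₂ θ (C α) W := by
    rw [X_dvd_iff, coeff_zero_eq_eval_zero, ← coe_evalRingHom, hom_eval₂]
    rw [eval_map] at hwα
    simpa using hwα
  obtain ⟨m1, hm1⟩ := hroot1
  obtain ⟨m2, hm2⟩ := hroot2
  have h2 := Phi_mul (two_eq_zero' K[X]) (C α) (X : K[X]) 1 t
  rw [h1, hm1, hm2] at h2
  have h3 := congrArg (fun p => eval 0 (derivative p)) h2
  have htK : (t : K) = 1 := by
    obtain ⟨i, rfl⟩ := htodd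
    push_cast; rw [two_eq_zero' K]; ring
  have ht1 : t - 1 ≠ 0 := by omega
  simp [derivative_pow, htK, ht1] at h3
  exact hne1 (eq_zero_of_pow_eq_zero h3.symm)

end NotDvd
end KasamiAPN

namespace KasamiAPN
open Polynomial

section Direction
variable {K : Type*} [Field K] [CharP K 2]

/-- `φ_j` with generic `y, z`, as a polynomial in `x`. -/
noncomputable def FF (K : Type*) [Field K] (j : ℕ) : (MvPolynomial (Fin 2) K)[X] :=
  Phi (X : (MvPolynomial (Fin 2) K)[X]) (C (MvPolynomial.X 0)) (C (MvPolynomial.X 1)) j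

lemma FF_irred_odd (j : ℕ) (h3 : 3 ≤ j) (h : Irreducible (FF K j)) : Odd j ∧ 5 ≤ j := by
  have hodd : Odd j := by
    by_contra hne
    rw [Nat.not_odd_iff_even] at hne
    obtain ⟨i, rfl⟩ := hne
    let Y0 : MvPolynomial (Fin 2) K := MvPolynomial.X 0
    let Y1 : MvPolynomial (Fin 2) K := MvPolynomial.X 1
    have h2 := two_eq_zero' (MvPolynomial (Fin 2) K)[X]
    have hY : Y0 + Y1 ≠ 0 := by
      intro h0
      have := congrArg (MvPolynomial.eval ![(1 : K), 0]) h0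
      simp [Y0, Y1] at this
    have he3 : (X + C Y0) * (X + C Y1) * (C Y0 + C Y1) ≠ 0 := by
      refine mul_ne_zero (mul_ne_zero (X_add_C_ne_zero _) (X_add_C_ne_zero _)) ?_
      rw [← C_add]; exact C_ne_zero.2 hY
    have key : FF K (i + i) = (X + C Y0) * ((X + C Y1) * ((C Y0 + C Y1) * FF K i ^ 2)) := by
      apply mul_left_cancel₀ he3
      have e1 := Phi_mul h2 X (C Y0) (C Y1) (i + i)
      have e2 := Phi_mul h2 X (C Y0) (C Y1) i
      have e3 : X ^ (i + i) + C Y0 ^ (i + i) + C Y1 ^ (i + i) + (X + C Y0 + C Y1) ^ (i + i) =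
          (X ^ i + C Y0 ^ i + C Y1 ^ i + (X + C Y0 + C Y1) ^ i) ^ 2 := by
        simp only [pow_add]
        generalize (X : (MvPolynomial (Fin 2) K)[X]) ^ i = A1
        generalize C Y0 ^ i = A2
        generalize C Y1 ^ i = A3
        generalize (X + C Y0 + C Y1) ^ i = A4
        linear_combination -(A1 * A2 + A1 * A3 + A1 * A4 + A2 * A3 + A2 * A4 + A3 * A4) * h2
      rw [FF, e1, e3, ← e2, FF]
      ring
    have hu : ∀ Y : MvPolynomial (Fin 2) K, ¬ IsUnit (X + C Y) := fun Y =>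
      not_isUnit_of_natDegree_pos _ (by rw [natDegree_X_add_C]; exact one_pos)
    rcases h.isUnit_or_isUnit key with h' | h'
    · exact hu _ h'
    · exact hu _ (isUnit_of_mul_isUnit_left h')
  refine ⟨hodd, ?_⟩
  by_contra hlt
  obtain ⟨i, rfl⟩ := hodd
  have : i = 1 := by omega
  subst this
  exact h.not_isUnit (by simp [FF, Phi])

variable [IsAlgClosed K]

lemma exists_grid (P : MvPolynomial (Fin 2) K) (hP : P ≠ 0) : ∃ N1 : ℕ, ∀ N ≥ N1,
    ∃ b c : K, b ^ 2 ^ N = b ∧ c ^ 2 ^ N = c ∧ MvPolynomial.eval ![b, c] P ≠ 0 := by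
  refine ⟨P.totalDegree + 1, fun N hN => ?_⟩
  by_contra hcon
  push Not at hcon
  obtain ⟨F, hFc, hF⟩ := card_fixed (K := K) N (by omega)
  apply hP
  apply MvPolynomial.eq_zero_of_eval_zero_at_prod_finset P (fun _ => F)
  · intro i
    rw [hFc]
    have := MvPolynomial.degreeOf_le_totalDegree P i
    have h2 : N < 2 ^ N := Nat.lt_two_pow_self
    omega
  · intro x hx
    have h0 := (hF _).1 (hx 0)
    have h1 := (hF _).1 (hx 1)
    have := hcon _ _ h0 h1
    rwa [show ![x 0, x 1] = x by ext i; fin_cases i <;> rfl] at this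

lemma Phi_separable (k t : ℕ) (hk : 2 ≤ k) (ht : t = 2 ^ (2 * k) - 2 ^ k + 1) (b c : K)
    (hbc : (b + c) ^ t ≠ b ^ t + c ^ t) : (Phi (X : K[X]) (C b) (C c) t).Separable := by
  have h2 : (2 : K) = 0 := two_eq_zero' K
  have hk4 : 4 ≤ 2 ^ k := by
    calc 4 = 2 ^ 2 := by norm_num
      _ ≤ 2 ^ k := Nat.pow_le_pow_right (by norm_num) hk
  have hk2 : 2 ^ (2 * k) = 2 ^ k * 2 ^ k := by rw [two_mul, pow_add]
  have ht1 : t - 1 = (2 ^ k - 1) * 2 ^ k := by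
    rw [Nat.sub_mul, one_mul]; omega
  have ht0 : t = (t - 1) + 1 := by omega
  have htpos : t - 1 ≠ 0 := by
    rw [ht1]; exact Nat.mul_ne_zero (by omega) (by omega)
  have htK : (t : K) = 1 := by
    rw [ht0, ht1]; push_cast
    rw [h2, zero_pow (by omega)]; ring
  rw [Separable, isCoprime_iff_aeval_ne_zero_of_isAlgClosed K K]
  intro ξ
  by_contra hcon
  push Not at hcon
  obtain ⟨hξ, hξ'⟩ := hcon
  rw [coe_aeval_eq_eval] at hξ hξ'
  have hN := Phi_mul (two_eq_zero' K[X]) (X : K[X]) (C b) (C c) t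
  have e1 := congrArg (eval ξ) hN
  have e2 := congrArg (fun p => eval ξ (derivative p)) hN
  rw [eval_mul, hξ, mul_zero] at e1
  simp only [derivative_mul (g := Phi (X : K[X]) (C b) (C c) t), eval_add, eval_mul, hξ, hξ'] at e2
  simp [derivative_pow, htK] at e1 e2
  set a := b + c with ha
  have ha' : ξ + b + c = ξ + a := by rw [ha]; ring
  rw [ha'] at e1 e2
  have ha0 : a ≠ 0 := by
    intro h0
    apply hbc
    rw [h0, zero_pow (by omega)]
    have : c = b := by linear_combination h0 - b * h2
    rw [this]; linear_combination (-b ^ t) * h2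
  by_cases hξ0 : ξ = 0
  · rw [hξ0, zero_pow htpos, zero_add, zero_add] at e2
    exact ha0 (eq_zero_of_pow_eq_zero e2.symm)
  · have e3 : ξ ^ (2 ^ k - 1) = (ξ + a) ^ (2 ^ k - 1) := by
      have : (ξ ^ (2 ^ k - 1) + (ξ + a) ^ (2 ^ k - 1)) ^ 2 ^ k = 0 := by
        rw [add_pow_char_pow, ← pow_mul, ← pow_mul, ← ht1]; exact e2.symm
      have := eq_zero_of_pow_eq_zero this
      linear_combination this - (ξ + a) ^ (2 ^ k - 1) * h2
    have hs : ∀ x : K, x ^ 2 ^ k = x ^ (2 ^ k - 1) * x := fun x => by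
      rw [← pow_succ]; congr 1; omega
    have e4 : ξ ^ (2 ^ k - 1) = a ^ (2 ^ k - 1) := by
      have e5 : (ξ + a) ^ 2 ^ k = ξ ^ 2 ^ k + a ^ 2 ^ k := add_pow_char_pow ..
      rw [hs, hs, hs, ← e3] at e5
      apply mul_right_cancel₀ ha0
      linear_combination e5
    have e6 : ξ ^ (t - 1) = a ^ (t - 1) := by rw [ht1, pow_mul, pow_mul, e4]
    have e7 : (ξ + a) ^ (t - 1) = a ^ (t - 1) := by rw [ht1, pow_mul, pow_mul, ← e3, e4]
    apply hbc
    have e8 : ξ ^ t = a ^ (t - 1) * ξ := by rw [← e6, ← pow_succ, ← ht0]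
    have e9 : (ξ + a) ^ t = a ^ (t - 1) * (ξ + a) := by rw [← e7, ← pow_succ, ← ht0]
    have e10 : a ^ t = a ^ (t - 1) * a := by rw [← pow_succ, ← ht0]
    rw [e8, e9] at e1
    rw [e10]
    linear_combination (-1) * e1 + (- a ^ (t - 1) * ξ - b ^ t - c ^ t) * h2

lemma exists_direction (k t j : ℕ) (hk : 2 ≤ k) (ht : t = 2 ^ (2 * k) - 2 ^ k + 1) (h5 : 5 ≤ j)
    (hj : Odd j) (hjt : j < t) (hirr : Irreducible (FF K j)) :
    ∃ N1 : ℕ, ∀ N ≥ N1, ∃ b c : K, b ^ 2 ^ N = b ∧ c ^ 2 ^ N = c ∧ b ≠ c ∧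
      IsCoprime (Phi (X : K[X]) (C b) (C c) j) (Phi (X : K[X]) (C b) (C c) t) ∧
      (Phi (X : K[X]) (C b) (C c) t).Separable := by
  have hmon : (FF K j).Monic := (Phi_monic _ _ j (by omega) hj).1
  have hdeg : (FF K j).natDegree = j - 3 := (Phi_monic _ _ j (by omega) hj).2
  have hr := resultant_ne_zero_of_irreducible hmon hirr (Phi_not_dvd k t j hk ht h5 hj hjt)
  obtain ⟨u, v, -, -, huv⟩ := exists_mul_add_mul_eq_C_resultant (FF K j) (FF K t) le_rfl
    le_rfl (Or.inl (by omega))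
  change resultant (FF K j) (FF K t) ≠ 0 at hr
  set r := resultant (FF K j) (FF K t) with hrdef
  let m : MvPolynomial (Fin 2) K := (MvPolynomial.X 0 + MvPolynomial.X 1) ^ t +
    MvPolynomial.X 0 ^ t + MvPolynomial.X 1 ^ t
  have hm : m ≠ 0 := by
    intro h0
    have h1 := congrArg (MvPolynomial.aeval ![(X : K[X]), 1]) h0
    simp [m] at h1
    have h2 := line_id (K := K) t
    rw [zero_pow (by omega), add_zero] at h2
    have h3 : (X ^ 2 + X) * Phi (X : K[X]) (C 0) (C 1) t = 0 := by
      rw [h2, ← h1]; ring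
    have hX : (X ^ 2 + X : K[X]) ≠ 0 := by
      intro h
      have := congrArg (fun r => coeff r 1) h
      simp [coeff_X_pow] at this
    have htodd : Odd t := by
      have h1 : 2 ^ k ≤ 2 ^ (2 * k) := Nat.pow_le_pow_right (by norm_num) (by omega)
      have h2 : Even (2 ^ (2 * k) - 2 ^ k) := by
        rw [Nat.even_sub h1]
        simp [Nat.even_pow]
      rw [ht]; exact h2.add_one
    exact (Phi_monic (0 : K) 1 t (by omega) htodd).1.ne_zero ((mul_eq_zero.1 h3).resolve_left hX)
  obtain ⟨N1, hN1⟩ := exists_grid (r * m) (mul_ne_zero hr hm)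
  refine ⟨N1, fun N hN => ?_⟩
  obtain ⟨b, c, hb, hc, hne⟩ := hN1 N hN
  rw [map_mul] at hne
  have hr' := left_ne_zero_of_mul hne
  have hm' := right_ne_zero_of_mul hne
  have h2 : (2 : K) = 0 := two_eq_zero' K
  have hmbc : (b + c) ^ t ≠ b ^ t + c ^ t := by
    intro h
    apply hm'
    simp [m]
    rw [h]
    linear_combination (b ^ t + c ^ t) * h2
  refine ⟨b, c, hb, hc, ?_, ?_, Phi_separable k t hk ht b c hmbc⟩
  · rintro rfl
    apply hmbc
    have : b + b = 0 := by linear_combination b * h2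
    rw [this, zero_pow (by omega)]
    linear_combination (-b ^ t) * h2
  · have h1 := congrArg (mapRingHom (MvPolynomial.eval ![b, c])) huv
    have hFF : ∀ i, mapRingHom (MvPolynomial.eval ![b, c]) (FF K i) =
        Phi (X : K[X]) (C b) (C c) i := by
      intro i; rw [FF, Phi_map]; simp
    rw [map_add, map_mul, map_mul, hFF, hFF, coe_mapRingHom, map_C] at h1
    set ρ := MvPolynomial.eval ![b, c] r
    refine ⟨C ρ⁻¹ * u.map (MvPolynomial.eval ![b, c]), C ρ⁻¹ * v.map (MvPolynomial.eval ![b, c]), ?_⟩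
    calc _ = C ρ⁻¹ * (Phi (X : K[X]) (C b) (C c) j * u.map (MvPolynomial.eval ![b, c]) +
          Phi (X : K[X]) (C b) (C c) t * v.map (MvPolynomial.eval ![b, c])) := by ring
      _ = 1 := by rw [h1, ← C_mul, inv_mul_cancel₀ hr', C_1]

end Direction
end KasamiAPN

namespace KasamiAPN
open Polynomial

section Curve
variable {K : Type*} [Field K]

lemma swap_coeff (p : K[X][X]) (i k : ℕ) :
    ((Bivariate.swap p).coeff i).coeff k = (p.coeff k).coeff i := by
  induction p using Polynomial.induction_on' with
  | add p q hp hq => simp only [map_add, coeff_add, hp, hq]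
  | monomial n a =>
    induction a using Polynomial.induction_on' with
    | add p q hp hq => simp only [map_add, coeff_add, hp, hq]
    | monomial m r =>
      rw [Bivariate.swap_monomial_monomial]
      simp only [coeff_monomial]
      split_ifs <;> simp_all [coeff_monomial]

lemma swap_coeff_zero_monic {p : K[X][X]} (hp : p.Monic) :
    ((Bivariate.swap p).coeff 0).Monic ∧ ((Bivariate.swap p).coeff 0).natDegree = p.natDegree := by
  have h1 : ((Bivariate.swap p).coeff 0).natDegree ≤ p.natDegree := by
    rw [natDegree_le_iff_coeff_eq_zero]
    intro e he
    rw [swap_coeff, coeff_eq_zero_of_natDegree_lt he, coeff_zero]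
  have h2 : ((Bivariate.swap p).coeff 0).coeff p.natDegree = 1 := by
    rw [swap_coeff, hp.coeff_natDegree, coeff_one_zero]
  exact ⟨monic_of_natDegree_le_of_coeff_eq_one _ h1 h2,
    natDegree_eq_of_le_of_coeff_ne_zero h1 (by rw [h2]; exact one_ne_zero)⟩

lemma swap_coeff_degree_lt {p : K[X][X]} (hp : p.Monic) (i : ℕ) (hi : 0 < i) :
    ((Bivariate.swap p).coeff i).degree < ((Bivariate.swap p).coeff 0).degree := by
  obtain ⟨h1, h2⟩ := swap_coeff_zero_monic hp
  rw [degree_eq_natDegree h1.ne_zero, h2, degree_lt_iff_coeff_zero]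
  intro e he
  rw [swap_coeff]
  rcases he.eq_or_lt with rfl | he
  · rw [hp.coeff_natDegree, coeff_one, if_neg hi.ne']
  · rw [coeff_eq_zero_of_natDegree_lt he, coeff_zero]

lemma factor_vanish {p q : K[X][X]} (hp : p.Monic) (hq : q.Monic) (D : ℕ)
    (hc : IsCoprime ((Bivariate.swap p).coeff 0) ((Bivariate.swap q).coeff 0))
    (hv : ∀ i, 0 < i → i < D → (Bivariate.swap (p * q)).coeff i = 0) :
    ∀ i, 0 < i → i < D → (Bivariate.swap p).coeff i = 0 ∧ (Bivariate.swap q).coeff i = 0 := by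
  intro i
  induction i using Nat.strong_induction_on with
  | _ i ih =>
    intro hi hD
    have h := hv i hi hD
    rw [map_mul, coeff_mul] at h
    have hs : ∑ x ∈ Finset.HasAntidiagonal.antidiagonal i,
        (Bivariate.swap p).coeff x.1 * (Bivariate.swap q).coeff x.2 =
        (Bivariate.swap p).coeff 0 * (Bivariate.swap q).coeff i +
        (Bivariate.swap p).coeff i * (Bivariate.swap q).coeff 0 := by
      have hne : ((0, i) : ℕ × ℕ) ≠ (i, 0) := by
        intro h; simp only [Prod.mk.injEq] at h; omega
      rw [← Finset.sum_pair (f := fun x : ℕ × ℕ =>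
        (Bivariate.swap p).coeff x.1 * (Bivariate.swap q).coeff x.2) hne]
      symm
      apply Finset.sum_subset
      · intro x hx
        simp only [Finset.mem_insert, Finset.mem_singleton] at hx
        rcases hx with rfl | rfl <;> simp
      · rintro ⟨u, v⟩ hx hx'
        simp only [Finset.mem_insert, Finset.mem_singleton, Prod.mk.injEq,
          Finset.HasAntidiagonal.mem_antidiagonal] at hx hx'
        rw [(ih u (by omega) (by omega) (by omega)).1, zero_mul]
    rw [hs] at h
    constructor
    · apply eq_zero_of_dvd_of_degree_lt _ (swap_coeff_degree_lt hp i hi)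
      apply hc.dvd_of_dvd_mul_right
      exact ⟨-(Bivariate.swap q).coeff i, by linear_combination h⟩
    · apply eq_zero_of_dvd_of_degree_lt _ (swap_coeff_degree_lt hq i hi)
      apply hc.symm.dvd_of_dvd_mul_left
      exact ⟨-(Bivariate.swap p).coeff i, by linear_combination h⟩

lemma eq_one_of_swap_const {p q : K[X][X]} (hp : p.Monic)
    (h0 : ∀ i, 0 < i → (Bivariate.swap p).coeff i = 0) (i0 : ℕ)
    (hc : IsCoprime ((Bivariate.swap (p * q)).coeff i0) ((Bivariate.swap (p * q)).coeff 0)) :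
    p = 1 := by
  have hC : Bivariate.swap p = C ((Bivariate.swap p).coeff 0) := by
    ext1 i
    rw [coeff_C]
    split_ifs with h
    · rw [h]
    · exact h0 i (Nat.pos_of_ne_zero h)
  have hd : ∀ i, (Bivariate.swap p).coeff 0 ∣ (Bivariate.swap (p * q)).coeff i := by
    intro i
    rw [map_mul, hC, coeff_C_mul, coeff_C_zero]
    exact Dvd.intro _ rfl
  have hu := hc.isUnit_of_dvd' (hd i0) (hd 0)
  have h1 := (swap_coeff_zero_monic hp).1.eq_one_of_isUnit hu
  rw [h1] at hC
  have := congrArg Bivariate.swap hC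
  rwa [Bivariate.swap_swap_apply, map_one, map_one] at this

lemma irreducible_curve (Ψ : K[X][X]) (hm : Ψ.Monic) (h1 : Ψ ≠ 1) (D : ℕ)
    (hs : ((Bivariate.swap Ψ).coeff 0).Separable)
    (hv : ∀ i, 0 < i → i < D → (Bivariate.swap Ψ).coeff i = 0)
    (hd : (Bivariate.swap Ψ).natDegree < 2 * D) (i0 : ℕ)
    (hc : IsCoprime ((Bivariate.swap Ψ).coeff i0) ((Bivariate.swap Ψ).coeff 0)) :
    Irreducible Ψ := by
  rw [irreducible_of_monic hm h1]
  rintro p q hp hq rfl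
  have hcop : IsCoprime ((Bivariate.swap p).coeff 0) ((Bivariate.swap q).coeff 0) := by
    rw [map_mul, mul_coeff_zero] at hs
    exact hs.isCoprime
  have hvan := factor_vanish hp hq D hcop hv
  have hp0 : Bivariate.swap p ≠ 0 := by
    intro h
    exact (swap_coeff_zero_monic hp).1.ne_zero (by rw [h, coeff_zero])
  have hq0 : Bivariate.swap q ≠ 0 := by
    intro h
    exact (swap_coeff_zero_monic hq).1.ne_zero (by rw [h, coeff_zero])
  rw [map_mul, natDegree_mul hp0 hq0] at hd
  by_cases hpd : (Bivariate.swap p).natDegree < D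
  · left
    refine eq_one_of_swap_const (q := q) hp (fun i hi => ?_) i0 hc
    by_cases hiD : i < D
    · exact (hvan i hi hiD).1
    · exact coeff_eq_zero_of_natDegree_lt (by omega)
  · right
    rw [mul_comm] at hc
    refine eq_one_of_swap_const (q := p) hq (fun i hi => ?_) i0 hc
    by_cases hiD : i < D
    · exact (hvan i hi hiD).2
    · exact coeff_eq_zero_of_natDegree_lt (by omega)

end Curve
end KasamiAPN

namespace KasamiAPN
open Polynomial

section Curve2
variable {K : Type*} [Field K]

/-- the curve, as a polynomial in `s` over `K[x]`. -/
noncomputable def hat (F : K[X]) (b c : K) (t : ℕ) : K[X][X] :=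
  ∑ j ∈ Finset.range (t + 1), monomial (t - j) (C (F.coeff j) * Phi (X : K[X]) (C b) (C c) j)

lemma hat_coeff (F : K[X]) (b c : K) (t i : ℕ) : (hat F b c t).coeff i =
    if i ≤ t then C (F.coeff (t - i)) * Phi (X : K[X]) (C b) (C c) (t - i) else 0 := by
  unfold hat
  rw [finsetSum_coeff]
  simp only [coeff_monomial]
  split_ifs with h
  · rw [Finset.sum_eq_single (t - i)]
    · rw [if_pos (by omega)]
    · intro j hj hne
      simp only [Finset.mem_range] at hj
      rw [if_neg (by omega)]
    · intro h'; simp only [Finset.mem_range] at h'; omega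
  · apply Finset.sum_eq_zero
    intro j hj
    rw [if_neg (by omega)]

/-- the curve, as a polynomial in `x` over `K[s]`. -/
noncomputable def crv (F : K[X]) (b c : K) (t : ℕ) : K[X][X] := Bivariate.swap (hat F b c t)

lemma swap_crv (F : K[X]) (b c : K) (t : ℕ) : Bivariate.swap (crv F b c t) = hat F b c t :=
  Bivariate.swap_swap_apply _

lemma crv_coeff (F : K[X]) (b c : K) (t i e : ℕ) : ((crv F b c t).coeff e).coeff i =
    if i ≤ t then F.coeff (t - i) * (Phi (X : K[X]) (C b) (C c) (t - i)).coeff e else 0 := by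
  unfold crv
  rw [swap_coeff, hat_coeff]
  split_ifs
  · rw [coeff_C_mul]
  · rw [coeff_zero]

lemma crv_YD (F : K[X]) (b c : K) (t : ℕ) : YD (crv F b c t) t := by
  intro e
  rw [natDegree_le_iff_coeff_eq_zero]
  intro i hi
  rw [crv_coeff, if_neg (by omega)]

lemma crv_monic (F : K[X]) (b c : K) (t : ℕ) (h3 : 3 ≤ t) (ho : Odd t) (hF : F.coeff t = 1) :
    (crv F b c t).Monic ∧ (crv F b c t).natDegree = t - 3 := by
  have h1 : (crv F b c t).natDegree ≤ t - 3 := by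
    rw [natDegree_le_iff_coeff_eq_zero]
    intro e he
    ext i
    rw [crv_coeff, coeff_zero]
    split_ifs
    · rw [Phi_degree _ _ _ _ (by omega), mul_zero]
    · rfl
  have h2 : (crv F b c t).coeff (t - 3) = 1 := by
    ext i
    rw [crv_coeff, coeff_one]
    rcases Nat.eq_zero_or_pos i with rfl | hi
    · obtain ⟨hm, hd⟩ := Phi_monic b c t h3 ho
      rw [if_pos (Nat.zero_le _), if_pos rfl, Nat.sub_zero, hF, one_mul, ← hd]
      exact hm.coeff_natDegree
    · rw [if_neg hi.ne']
      split_ifs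
      · rw [Phi_degree _ _ _ _ (by omega), mul_zero]
      · rfl
  exact ⟨monic_of_natDegree_le_of_coeff_eq_one _ h1 h2,
    natDegree_eq_of_le_of_coeff_ne_zero h1 (by rw [h2]; exact one_ne_zero)⟩

lemma crv_eval (F : K[X]) (b c : K) (t : ℕ) (s x : K) : evalEval s x (crv F b c t) =
    ∑ j ∈ Finset.range (t + 1), F.coeff j * Phi x b c j * s ^ (t - j) := by
  unfold crv hat
  rw [map_sum, evalEval_finsetSum]
  apply Finset.sum_congr rfl
  intro j _
  have := Phi_map (evalRingHom x) (X : K[X]) (C b) (C c) j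
  simp only [coe_evalRingHom, eval_X, eval_C] at this
  rw [Bivariate.swap_monomial, evalEval, eval_mul, eval_map, eval₂_at_apply, eval_C]
  simp [this]

lemma Phi_coeff_fixed [CharP K 2] (b c : K) (N j e : ℕ) (hb : b ^ 2 ^ N = b) (hc : c ^ 2 ^ N = c) :
    (Phi (X : K[X]) (C b) (C c) j).coeff e ^ 2 ^ N = (Phi (X : K[X]) (C b) (C c) j).coeff e := by
  have := Phi_map (mapRingHom (iterateFrobenius K 2 N)) (X : K[X]) (C b) (C c) j
  have h2 := congrArg (fun p => coeff p e) this
  simpa [iterateFrobenius_def, hb, hc] using h2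

lemma eval_triple (F : K[X]) (h2 : (2 : K) = 0) (t : ℕ) (hF : F.natDegree ≤ t) (s x b c : K)
    (hs : s ≠ 0)
    (h : ∑ j ∈ Finset.range (t + 1), F.coeff j * Phi x b c j * s ^ (t - j) = 0) :
    eval (x / s) F + eval (b / s) F + eval (c / s) F + eval (x / s + b / s + c / s) F = 0 := by
  have key : ∀ u : K, s ^ t * eval (u / s) F =
      ∑ j ∈ Finset.range (t + 1), F.coeff j * u ^ j * s ^ (t - j) := by
    intro u
    rw [eval_eq_sum_range' (Nat.lt_succ_of_le hF), Finset.mul_sum]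
    apply Finset.sum_congr rfl
    intro j hj
    have hj' : j ≤ t := by simpa [Nat.lt_succ_iff] using hj
    have : s ^ t = s ^ (t - j) * s ^ j := by rw [← pow_add]; congr 1; omega
    rw [this, div_pow]
    field_simp
  apply (mul_right_injective₀ (pow_ne_zero t hs))
  simp only [mul_zero]
  rw [← add_div, ← add_div, mul_add, mul_add, mul_add, key, key, key, key,
    ← Finset.sum_add_distrib, ← Finset.sum_add_distrib, ← Finset.sum_add_distrib]
  have h' := congrArg (fun w => (x + b) * (x + c) * (b + c) * w) h
  simp only [mul_zero, Finset.mul_sum] at h'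
  rw [← h']
  apply Finset.sum_congr rfl
  intro j _
  linear_combination (-F.coeff j * s ^ (t - j)) * Phi_mul h2 x b c j

lemma eval_C_ne_zero (Ψ : K[X][X]) (hm : Ψ.Monic) (hi : Irreducible Ψ) (hd : 1 < Ψ.natDegree)
    (a : K[X]) : eval a Ψ ≠ 0 := by
  intro h
  have h1 : (X - C a) ∣ Ψ := dvd_iff_isRoot.2 h
  have h2 := (irreducible_X_sub_C a).associated_of_dvd hi h1
  have h3 := eq_of_monic_of_associated (monic_X_sub_C a) hm h2
  rw [← h3, natDegree_X_sub_C] at hd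
  omega

lemma eval_C_roots [DecidableEq K] (Ψ : K[X][X]) (t : ℕ) (h : YD Ψ t) (a : K) :
    (eval (C a) Ψ).roots.toFinset.card ≤ t := by
  refine (Multiset.toFinset_card_le _).trans ((card_roots' _).trans ?_)
  rw [eval_eq_sum_range]
  apply natDegree_sum_le_of_forall_le
  intro i _
  rw [← C_pow]
  exact (natDegree_mul_C_le _ _).trans (h i)

variable [IsAlgClosed K] [CharP K 2]

lemma exists_triple (k t j : ℕ) (hk : 2 ≤ k) (ht : t = 2 ^ (2 * k) - 2 ^ k + 1) (h5 : 5 ≤ j)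
    (hj : Odd j) (hjt : j < t) (hirr : Irreducible (FF K j)) :
    ∃ N0 : ℕ, ∀ N ≥ N0, ∀ G : K[X], G.natDegree ≤ 2 ^ (2 * k - 1) - 2 ^ (k - 1) + 1 →
      G.coeff j ≠ 0 → (∀ i, G.coeff i ^ 2 ^ N = G.coeff i) →
      ∃ x y z : K, x ^ 2 ^ N = x ∧ y ^ 2 ^ N = y ∧ z ^ 2 ^ N = z ∧ x ≠ y ∧ x ≠ z ∧ y ≠ z ∧
        eval x (X ^ t + G) + eval y (X ^ t + G) + eval z (X ^ t + G) +
          eval (x + y + z) (X ^ t + G) = 0 := by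
  classical
  obtain ⟨D, hD1, hD2, hD3, hto⟩ : ∃ D, t = 2 * D + 1 ∧
      2 ^ (2 * k - 1) - 2 ^ (k - 1) + 1 = D + 1 ∧ 6 ≤ D ∧ Odd t := by
    obtain ⟨m, rfl⟩ : ∃ m, k = m + 1 := ⟨k - 1, by omega⟩
    have hA : 2 ≤ 2 ^ m := by
      calc 2 = 2 ^ 1 := by norm_num
        _ ≤ 2 ^ m := Nat.pow_le_pow_right (by norm_num) (by omega)
    have e1 : 2 ^ (2 * (m + 1)) = 4 * (2 ^ m * 2 ^ m) := by
      rw [show 2 * (m + 1) = m + m + 2 by ring, pow_add, pow_add]; ring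
    have e2 : 2 ^ (2 * (m + 1) - 1) = 2 * (2 ^ m * 2 ^ m) := by
      rw [show 2 * (m + 1) - 1 = m + m + 1 by omega, pow_add, pow_add]; ring
    have e3 : 2 ^ (m + 1) = 2 * 2 ^ m := by ring
    rw [e1, e3] at ht
    rw [e2, Nat.add_sub_cancel]
    have hB : 2 * 2 ^ m ≤ 2 ^ m * 2 ^ m := Nat.mul_le_mul_right _ hA
    generalize 2 ^ m * 2 ^ m = B at *
    generalize 2 ^ m = A at *
    refine ⟨2 * B - A, by omega, rfl, by omega, ⟨2 * B - A, by omega⟩⟩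
  obtain ⟨N1, hN1⟩ := exists_direction k t j hk ht h5 hj hjt hirr
  obtain ⟨N2, hN2⟩ := exists_points (K := K) (t - 3) t (1 + t + t) (by omega)
  refine ⟨max N1 N2, fun N hN G hG hGj hfix => ?_⟩
  obtain ⟨b, c, hb, hc, hbc, hcop, hsep⟩ := hN1 N (le_of_max_le_left hN)
  rw [hD2] at hG
  set F : K[X] := X ^ t + G with hF
  have hFc : ∀ i, F.coeff i = (if i = t then 1 else 0) + G.coeff i := by
    intro i; rw [hF, coeff_add, coeff_X_pow]
  have hFt : F.coeff t = 1 := by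
    rw [hFc, if_pos rfl, coeff_eq_zero_of_natDegree_lt (by omega), add_zero]
  have hFd : F.natDegree ≤ t := by
    rw [hF]
    exact natDegree_add_le_of_degree_le (natDegree_X_pow_le _) (by omega)
  have hFfix : ∀ i, F.coeff i ^ 2 ^ N = F.coeff i := by
    intro i
    by_cases h : i = t
    · rw [h, hFt, one_pow]
    · rw [hFc, if_neg h, zero_add, hfix]
  obtain ⟨hm, hd⟩ := crv_monic F b c t (by omega) hto hFt
  have h0 : (hat F b c t).coeff 0 = Phi (X : K[X]) (C b) (C c) t := by
    rw [hat_coeff, if_pos (Nat.zero_le _), Nat.sub_zero, hFt, C_1, one_mul]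
  have hjj : (hat F b c t).coeff (t - j) = C (G.coeff j) * Phi (X : K[X]) (C b) (C c) j := by
    rw [hat_coeff, if_pos (by omega), show t - (t - j) = j by omega, hFc, if_neg (by omega),
      zero_add]
  have hirrΨ : Irreducible (crv F b c t) := by
    refine irreducible_curve _ hm ?_ D ?_ ?_ ?_ (t - j) ?_
    · intro h
      rw [h, natDegree_one] at hd
      omega
    · rw [swap_crv, h0]; exact hsep
    · intro i hi hiD
      rw [swap_crv, hat_coeff, if_pos (by omega), hFc, if_neg (by omega),
        coeff_eq_zero_of_natDegree_lt (by omega), add_zero, C_0, zero_mul]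
    · rw [swap_crv]
      refine lt_of_le_of_lt (b := t - 3) ?_ (by omega)
      rw [natDegree_le_iff_coeff_eq_zero]
      intro i hi
      rw [hat_coeff]
      split_ifs
      · have : t - i = 0 ∨ t - i = 1 ∨ t - i = 2 := by omega
        rcases this with h | h | h <;> rw [h] <;> simp [Phi]
      · rfl
    · rw [swap_crv, h0, hjj]
      exact (isCoprime_mul_unit_left_left (isUnit_C.2 hGj.isUnit) _ _).2 hcop
  have hder : derivative (crv F b c t) ≠ 0 := by
    intro h
    have hdP : derivative (Phi (X : K[X]) (C b) (C c) t) = 0 := by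
      ext e
      rw [coeff_derivative, coeff_zero]
      have := congrArg (fun p => (p.coeff e).coeff 0) h
      simp only [coeff_derivative, coeff_zero] at this
      have hcast : ((e : K[X]) + 1) = C ((e : K) + 1) := by simp
      rw [hcast, coeff_mul_C, crv_coeff, if_pos (Nat.zero_le _), Nat.sub_zero, hFt, one_mul] at this
      exact this
    rw [Separable, hdP, isCoprime_zero_right] at hsep
    have := natDegree_eq_zero_of_isUnit hsep
    rw [(Phi_monic b c t (by omega) hto).2] at this
    omega
  have hYD := crv_YD F b c t
  set Bad : Finset K := {0} ∪ (eval (C b) (crv F b c t)).roots.toFinset ∪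
    (eval (C c) (crv F b c t)).roots.toFinset with hBad
  have hBc : Bad.card ≤ 1 + t + t := by
    refine (Finset.card_union_le _ _).trans (Nat.add_le_add
      ((Finset.card_union_le _ _).trans (Nat.add_le_add ?_ ?_)) ?_)
    · simp
    · exact eval_C_roots _ _ hYD _
    · exact eval_C_roots _ _ hYD _
  obtain ⟨s, x, hsB, hs, hx, hev⟩ := hN2 N (le_of_max_le_right hN) _ hm hd hirrΨ hder hYD
    (by
      intro i e
      rw [crv_coeff]
      split_ifs
      · rw [mul_pow, hFfix, Phi_coeff_fixed _ _ _ _ _ hb hc]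
      · rw [zero_pow (pow_ne_zero _ two_ne_zero)]) Bad hBc
  simp only [hBad, Finset.mem_union, Finset.mem_singleton, Multiset.mem_toFinset, not_or] at hsB
  obtain ⟨⟨hs0, hsb⟩, hsc⟩ := hsB
  rw [mem_roots (eval_C_ne_zero _ hm hirrΨ (by omega) _)] at hsb hsc
  have hxb : x ≠ b := by rintro rfl; exact hsb hev
  have hxc : x ≠ c := by rintro rfl; exact hsc hev
  rw [crv_eval] at hev
  refine ⟨x / s, b / s, c / s, by rw [div_pow, hx, hs], by rw [div_pow, hb, hs],
    by rw [div_pow, hc, hs], ?_, ?_, ?_, eval_triple F (two_eq_zero' K) t hFd s x b c hs0 hev⟩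
  · intro h; exact hxb ((div_left_inj' hs0).1 h)
  · intro h; exact hxc ((div_left_inj' hs0).1 h)
  · intro h; exact hbc ((div_left_inj' hs0).1 h)

end Curve2
end KasamiAPN

namespace KasamiAPN
open Polynomial

lemma FF_irreducible_of_phi (K : Type*) [Field K] (j : ℕ)
    (h : Irreducible (Phi (MvPolynomial.X 0 : MvPolynomial (Fin 3) K) (MvPolynomial.X 1)
      (MvPolynomial.X 2) j)) : Irreducible (FF K j) := by
  have h1 := (MulEquiv.irreducible_iff (MvPolynomial.finSuccEquiv K 2)).2 h
  have h2 := Phi_map (MvPolynomial.finSuccEquiv K 2 : MvPolynomial (Fin 3) K ≃ₐ[K] _).toRingEquiv.toRingHom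
    (MvPolynomial.X 0 : MvPolynomial (Fin 3) K) (MvPolynomial.X 1) (MvPolynomial.X 2) j
  have e0 : MvPolynomial.finSuccEquiv K 2 (MvPolynomial.X 0) = X :=
    MvPolynomial.finSuccEquiv_X_zero
  have e1 : MvPolynomial.finSuccEquiv K 2 (MvPolynomial.X 1) = C (MvPolynomial.X 0) :=
    MvPolynomial.finSuccEquiv_X_succ (j := (0 : Fin 2))
  have e2 : MvPolynomial.finSuccEquiv K 2 (MvPolynomial.X 2) = C (MvPolynomial.X 1) :=
    MvPolynomial.finSuccEquiv_X_succ (j := (1 : Fin 2))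
  change MvPolynomial.finSuccEquiv K 2 _ = Phi (MvPolynomial.finSuccEquiv K 2 _)
    (MvPolynomial.finSuccEquiv K 2 _) (MvPolynomial.finSuccEquiv K 2 _) j at h2
  rw [e0, e1, e2] at h2
  rw [h2] at h1
  exact h1

lemma pow_natCard_eq {E : Type*} [Field E] [Finite E] (x : E) : x ^ Nat.card E = x := by
  have := Fintype.ofFinite E
  rw [Nat.card_eq_fintype_card, FiniteField.pow_card]

lemma exists_preimage {E Ω : Type*} [Field E] [Finite E] [Field Ω] [IsAlgClosed Ω] [CharP Ω 2]
    (e : E →+* Ω) (N : ℕ) (hN : N ≠ 0) (hE : Nat.card E = 2 ^ N) (x : Ω) (hx : x ^ 2 ^ N = x) :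
    ∃ y, e y = x := by
  classical
  obtain ⟨F, hF, hFm⟩ := card_fixed (K := Ω) N hN
  have := Fintype.ofFinite E
  have hsub : Finset.univ.image e ⊆ F := by
    intro z hz
    obtain ⟨y, -, rfl⟩ := Finset.mem_image.1 hz
    rw [hFm, ← map_pow, ← hE, pow_natCard_eq]
  have heq := Finset.eq_of_subset_of_card_le hsub (by
    rw [hF, Finset.card_image_of_injective _ e.injective, Finset.card_univ, ← Nat.card_eq_fintype_card, hE])
  have hxF := (hFm x).2 hx
  rw [← heq] at hxF
  obtain ⟨y, -, hy⟩ := Finset.mem_image.1 hxF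
  exact ⟨y, hy⟩

end KasamiAPN

namespace KasamiAPN
open Polynomial
lemma not_APN {E : Type} [Field E] [Finite E] [CharP E 2] (g : E → E) (x y z : E) (hxy : x ≠ y)
    (hxz : x ≠ z) (hyz : y ≠ z) (h : g x + g y + g z + g (x + y + z) = 0) : ¬ IsAPN g := by
  classical
  intro hA
  have h2 : (2 : E) = 0 := two_eq_zero' E
  have ha : x + y ≠ 0 := by
    intro h0
    exact hxy (by linear_combination h0 - y * h2)
  have h3 := hA (x + y) (g x + g y) ha
  have hsub : (({x, y, z} : Finset E) : Set E) ⊆ {u : E | g (u + (x + y)) + g u = g x + g y} := by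
    intro u hu
    simp only [Finset.coe_insert, Finset.coe_singleton, Set.mem_insert_iff,
      Set.mem_singleton_iff] at hu
    simp only [Set.mem_ofPred_eq]
    rcases hu with rfl | rfl | rfl
    · rw [show u + (u + y) = y by linear_combination u * h2, add_comm]
    · rw [show u + (x + u) = x by linear_combination u * h2]
    · rw [show u + (x + y) = x + y + u by ring]
      linear_combination h - (g x + g y) * h2
  have h4 := Set.ncard_le_ncard hsub (Set.toFinite _)
  rw [Set.ncard_coe_finset, Finset.card_eq_three.2 ⟨x, y, z, hxy, hxz, hyz, rfl⟩] at h4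
  omega

lemma main_aux (n : ℕ) (hn : 1 ≤ n)
    (k : ℕ) (hk : 2 ≤ k) (t : ℕ) (ht : t = 2 ^ (2 * k) - 2 ^ k + 1)
    (g : Polynomial (GaloisField 2 n))
    (hg : g.natDegree ≤ 2 ^ (2 * k - 1) - 2 ^ (k - 1) + 1)
    (j : ℕ) (h3 : 3 ≤ j) (hgj : g.coeff j ≠ 0)
    (hirr : Irreducible (FF (AlgebraicClosure (ZMod 2)) j)) :
    {m : ℕ | 1 ≤ m ∧ ∀ ι : GaloisField 2 n →+* GaloisField 2 (n * m),
      IsAPN (fun x => Polynomial.eval x ((X ^ t + g).map ι))}.Finite := by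
  have : CharP (AlgebraicClosure (ZMod 2)) 2 :=
    charP_of_injective_algebraMap (algebraMap (ZMod 2) (AlgebraicClosure (ZMod 2))).injective 2
  obtain ⟨hodd, h5⟩ := FF_irred_odd j h3 hirr
  have hjt : j < t := by
    have h1 : j ≤ g.natDegree := le_natDegree_of_ne_zero hgj
    obtain ⟨m, rfl⟩ : ∃ m, k = m + 1 := ⟨k - 1, by omega⟩
    have hA : 2 ≤ 2 ^ m := by
      calc 2 = 2 ^ 1 := by norm_num
        _ ≤ 2 ^ m := Nat.pow_le_pow_right (by norm_num) (by omega)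
    have e1 : 2 ^ (2 * (m + 1)) = 4 * (2 ^ m * 2 ^ m) := by
      rw [show 2 * (m + 1) = m + m + 2 by ring, pow_add, pow_add]; ring
    have e2 : 2 ^ (2 * (m + 1) - 1) = 2 * (2 ^ m * 2 ^ m) := by
      rw [show 2 * (m + 1) - 1 = m + m + 1 by omega, pow_add, pow_add]; ring
    have e3 : 2 ^ (m + 1) = 2 * 2 ^ m := by ring
    rw [e1, e3] at ht
    rw [e2, Nat.add_sub_cancel] at hg
    have hB : 2 * 2 ^ m ≤ 2 ^ m * 2 ^ m := Nat.mul_le_mul_right _ hA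
    generalize 2 ^ m * 2 ^ m = B at *
    generalize 2 ^ m = A at *
    omega
  obtain ⟨N0, hN0⟩ := exists_triple k t j hk ht h5 hodd hjt hirr
  apply (Set.finite_Iio N0).subset
  rintro m ⟨hm, hA⟩
  by_contra hcon
  simp only [Set.mem_Iio, not_lt] at hcon
  have hnm : m ≤ n * m := Nat.le_mul_of_pos_left m hn
  have hnm0 : n * m ≠ 0 := by omega
  have hcard := GaloisField.card 2 (n * m) hnm0
  obtain ⟨ι⟩ : Nonempty (GaloisField 2 n →ₐ[ZMod 2] GaloisField 2 (n * m)) := by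
    apply FiniteField.nonempty_algHom_of_finrank_dvd
    rw [GaloisField.finrank 2 (by omega), GaloisField.finrank 2 hnm0]
    exact Dvd.intro _ rfl
  let e : GaloisField 2 (n * m) →ₐ[ZMod 2] AlgebraicClosure (ZMod 2) := IsAlgClosed.lift
  have hpow : ∀ x : GaloisField 2 (n * m), e x ^ 2 ^ (n * m) = e x := by
    intro x
    rw [← map_pow, ← hcard, pow_natCard_eq]
  obtain ⟨x, y, z, hx, hy, hz, hxy, hxz, hyz, h⟩ := hN0 (n * m) (by omega)
    (g.map ((e : GaloisField 2 (n * m) →+* _).comp (ι : GaloisField 2 n →+* _)))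
    (natDegree_map_le.trans hg) (by
      rw [coeff_map]; exact (_root_.map_ne_zero _).2 hgj) (by
      intro i; rw [coeff_map]; exact hpow _)
  obtain ⟨x, rfl⟩ := exists_preimage (e : GaloisField 2 (n * m) →+* _) _ hnm0 hcard x hx
  obtain ⟨y, rfl⟩ := exists_preimage (e : GaloisField 2 (n * m) →+* _) _ hnm0 hcard y hy
  obtain ⟨z, rfl⟩ := exists_preimage (e : GaloisField 2 (n * m) →+* _) _ hnm0 hcard z hz
  refine not_APN _ x y z (fun h => hxy (by rw [h])) (fun h => hxz (by rw [h]))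
    (fun h => hyz (by rw [h])) ?_ (hA (ι : GaloisField 2 n →+* _))
  apply (e : GaloisField 2 (n * m) →+* AlgebraicClosure (ZMod 2)).injective
  have hmap : (X ^ t + g.map ((e : GaloisField 2 (n * m) →+* AlgebraicClosure (ZMod 2)).comp
      (ι : GaloisField 2 n →+* _))) = ((X ^ t + g).map (ι : GaloisField 2 n →+* _)).map
      (e : GaloisField 2 (n * m) →+* AlgebraicClosure (ZMod 2)) := by
    rw [Polynomial.map_map, Polynomial.map_add, Polynomial.map_pow, map_X]
  rw [hmap, ← map_add, ← map_add, eval_map_apply, eval_map_apply, eval_map_apply,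
    eval_map_apply, ← map_add, ← map_add, ← map_add] at h
  rw [h, map_zero]

end KasamiAPN

open MvPolynomial

/-- Férard–Oyono–Rodier: Let `L = F_{2^n}`, `t = 2^(2k) - 2^k + 1` (k ≥ 2), and
`f(x) = x^t + g(x) ∈ L[x]` with `deg g ≤ 2^(2k-1) - 2^(k-1) + 1`.  If there is an index
`j ≥ 3` with `g`'s coefficient `a_j ≠ 0` such that `φ_j(x,y,z)` — the (unique) quotient of
`x^j + y^j + z^j + (x+y+z)^j` by `(x+y)(x+z)(y+z)` in `F_2[x,y,z]` — is absolutely irreducible,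
then `f` is not exceptional APN. -/
theorem kasami_plus_lowdeg_abs_irred_coeff_not_exceptional_APN (n : ℕ) (hn : 1 ≤ n)
    (k : ℕ) (hk : 2 ≤ k) (t : ℕ) (ht : t = 2 ^ (2 * k) - 2 ^ k + 1)
    (g : Polynomial (GaloisField 2 n))
    (hg : g.natDegree ≤ 2 ^ (2 * k - 1) - 2 ^ (k - 1) + 1)
    (f : Polynomial (GaloisField 2 n)) (hf : f = Polynomial.X ^ t + g)
    (hj : ∃ j : ℕ, 3 ≤ j ∧ g.coeff j ≠ 0 ∧
      ∀ phi : MvPolynomial (Fin 3) (ZMod 2),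
        phi * ((X 0 + X 1) * (X 0 + X 2) * (X 1 + X 2)) =
          X 0 ^ j + X 1 ^ j + X 2 ^ j + (X 0 + X 1 + X 2) ^ j →
        Irreducible (MvPolynomial.map
          (algebraMap (ZMod 2) (AlgebraicClosure (ZMod 2))) phi)) :
    {m : ℕ | 1 ≤ m ∧ ∀ ι : GaloisField 2 n →+* GaloisField 2 (n * m),
      IsAPN (fun x => Polynomial.eval x (f.map ι))}.Finite := by
  obtain ⟨j, h3, hgj, hirr⟩ := hj
  subst hf
  refine KasamiAPN.main_aux n hn k hk t ht g hg j h3 hgj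
    (KasamiAPN.FF_irreducible_of_phi _ j ?_)
  have h := hirr (KasamiAPN.Phi (X 0) (X 1) (X 2) j) (by
    rw [mul_comm]
    exact KasamiAPN.Phi_mul (KasamiAPN.two_eq_zero' _) _ _ _ _)
  rw [KasamiAPN.Phi_map] at h
  simpa only [map_X] using h
end

section
/- Let k ≥ 2 and let t = 2^{2k} − 2^k + 1 be the Kasami–Welch number. Then there exists a family of polynomials P_α ∈ F_{2^k}[x,y], indexed by the elements α ∈ F_{2^k} \ F_2, such that φ_t(x,y) = ∏_{α ∈ F_{2^k} \ F_2} P_α(x,y), each P_α is absolutely irreducible (irreducible over an algebraic closure of F_{2^k}) of total degree 2^k + 1, and P_α(x,0) = (x + α)^{2^k + 1} for each α. -/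
open MvPolynomial

/-- The explicit factor, as an expression in any commutative ring. -/
def kasP {A : Type*} [CommRing A] (k : ℕ) (γ x y : A) : A :=
  (x + y + γ * (y + 1)) ^ (2 ^ k + 1) + (γ ^ 2 + γ) * (y ^ 2 ^ k + y) +
    ∑ i ∈ Finset.range k, (γ ^ 2 + γ) ^ 2 ^ i *
      (x + y + γ * (y + 1)) ^ (2 ^ k + 1 - 2 ^ (i + 1)) * y ^ 2 ^ i

theorem map_kasP {A B : Type*} [CommRing A] [CommRing B] (f : A →+* B) (k : ℕ) (γ x y : A) :
    f (kasP k γ x y) = kasP k (f γ) (f x) (f y) := by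
  simp [kasP]

theorem kasP_zero {A : Type*} [CommRing A] (k : ℕ) (γ x : A) :
    kasP k γ x 0 = (x + γ) ^ (2 ^ k + 1) := by
  simp [kasP]

theorem pow_le_aux {k i : ℕ} (hi : i ∈ Finset.range k) : 2 ^ (i + 1) ≤ 2 ^ k :=
  Nat.pow_le_pow_right (by norm_num) (by simpa using hi)

/-- telescoping sum -/
theorem tele {A : Type*} [CommRing A] [CharP A 2] (k n : ℕ) (hn : n ≤ k) (u : A) :
    ∑ i ∈ Finset.range n, u ^ (2 ^ k + 1 - 2 ^ (i + 1)) * (u + 1) ^ 2 ^ i =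
      u ^ (2 ^ k + 1 - 2 ^ n) + u ^ 2 ^ k := by
  induction n with
  | zero => simp [CharTwo.add_self_eq_zero]
  | succ n ih =>
    rw [Finset.sum_range_succ, ih (by omega), add_pow_char_pow, one_pow, mul_add, ← pow_add]
    have h1 : 2 ^ (n + 1) ≤ 2 ^ k := Nat.pow_le_pow_right (by norm_num) hn
    have h2 : 2 ^ k + 1 - 2 ^ (n + 1) + 2 ^ n = 2 ^ k + 1 - 2 ^ n := by
      rw [pow_succ] at *; omega
    rw [h2]
    grind

/-- restriction to the line w = 0 -/
theorem kasP_line0 {A : Type*} [CommRing A] [CharP A 2] (k : ℕ) (γ u : A) :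
    kasP k γ ((u + 1) + γ * u) (u + 1) = (γ ^ 2 + γ) * (u ^ 2 ^ k + u) := by
  have hw : (u + 1) + γ * u + (u + 1) + γ * (u + 1 + 1) = 0 := by grind
  unfold kasP
  rw [hw, Finset.sum_eq_zero, add_pow_char_pow]
  · rw [one_pow, show u ^ 2 ^ k + 1 + (u + 1) = u ^ 2 ^ k + u by grind]; simp
  · intro i hi
    have := pow_le_aux hi
    rw [zero_pow (by omega)]; simp

/-- restriction to the line w = ρ u -/
theorem kasP_line1 {A : Type*} [CommRing A] [CharP A 2] (k : ℕ) (γ ρ u : A)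
    (h1 : ρ ^ 2 = γ ^ 2 + γ) (h2 : ρ ^ 2 ^ k = ρ) :
    kasP k γ ((u + 1) + γ * u + ρ * u) (u + 1) = (ρ * u) ^ (2 ^ k + 1) := by
  have hw : (u + 1) + γ * u + ρ * u + (u + 1) + γ * (u + 1 + 1) = ρ * u := by grind
  unfold kasP
  rw [hw]
  have : ∑ i ∈ Finset.range k, (γ ^ 2 + γ) ^ 2 ^ i *
      (ρ * u) ^ (2 ^ k + 1 - 2 ^ (i + 1)) * (u + 1) ^ 2 ^ i =
      (γ ^ 2 + γ) * (u + u ^ 2 ^ k) := by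
    have h := tele k k le_rfl u
    rw [Nat.add_sub_cancel_left, pow_one] at h
    rw [← h, Finset.mul_sum]
    refine Finset.sum_congr rfl fun i hi => ?_
    have hi' := pow_le_aux hi
    have : (γ ^ 2 + γ) ^ 2 ^ i * ρ ^ (2 ^ k + 1 - 2 ^ (i + 1)) = γ ^ 2 + γ := by
      rw [← h1, ← pow_mul, ← pow_add, show 2 * 2 ^ i + (2 ^ k + 1 - 2 ^ (i + 1)) = 2 ^ k + 1 by
        rw [pow_succ] at *; omega, pow_succ, h2, sq]
    rw [mul_pow]
    linear_combination (u ^ (2 ^ k + 1 - 2 ^ (i + 1)) * (u + 1) ^ 2 ^ i) * this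
  rw [this, add_pow_char_pow, one_pow]
  clear this h1 h2 hw
  generalize (ρ * u) ^ (2 ^ k + 1) = a
  generalize u ^ 2 ^ k = b
  grind

/-- the polynomial -/
noncomputable def kasPoly {K : Type*} [Field K] (k : ℕ) (γ : K) : MvPolynomial (Fin 2) K :=
  kasP k (C γ) (X 0) (X 1)

theorem totalDegree_lin {K : Type*} [Field K] (a b c : K) :
    (C a * X 0 + C b * X 1 + C c : MvPolynomial (Fin 2) K).totalDegree ≤ 1 := by
  refine (totalDegree_add _ _).trans (max_le ((totalDegree_add _ _).trans (max_le ?_ ?_)) ?_)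
  · exact (totalDegree_mul _ _).trans (by simp)
  · exact (totalDegree_mul _ _).trans (by simp)
  · simp

theorem totalDegree_kasPoly_le {K : Type*} [Field K] (k : ℕ) (γ : K) :
    (kasPoly k γ).totalDegree ≤ 2 ^ k + 1 := by
  have hw : (X 0 + X 1 + C γ * (X 1 + 1) : MvPolynomial (Fin 2) K).totalDegree ≤ 1 := by
    have := totalDegree_lin (1 : K) (1 + γ) γ
    convert this using 2
    simp; ring
  have hwp (n : ℕ) :
      ((X 0 + X 1 + C γ * (X 1 + 1) : MvPolynomial (Fin 2) K) ^ n).totalDegree ≤ n :=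
    (totalDegree_pow _ _).trans (by nlinarith)
  have hg (n : ℕ) : ((C γ ^ 2 + C γ : MvPolynomial (Fin 2) K) ^ n).totalDegree = 0 := by
    rw [← C_pow, ← C_add, ← C_pow, totalDegree_C]
  have hg1 : ((C γ ^ 2 + C γ : MvPolynomial (Fin 2) K)).totalDegree = 0 := by
    simpa using hg 1
  have hpos : 0 < 2 ^ k := by positivity
  refine (totalDegree_add _ _).trans (max_le ((totalDegree_add _ _).trans (max_le ?_ ?_)) ?_)
  · exact hwp _
  · refine (totalDegree_mul _ _).trans ?_
    rw [hg1]
    have := totalDegree_add (X 1 ^ 2 ^ k : MvPolynomial (Fin 2) K) (X 1)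
    simp only [totalDegree_X_pow, totalDegree_X] at this
    have h2 : max (2 ^ k) 1 = 2 ^ k := by simp; omega
    omega
  · refine totalDegree_finsetSum_le fun i hi => ?_
    have hi' := pow_le_aux hi
    refine (totalDegree_mul _ _).trans ?_
    have := (totalDegree_mul ((C γ ^ 2 + C γ : MvPolynomial (Fin 2) K) ^ 2 ^ i)
      ((X 0 + X 1 + C γ * (X 1 + 1)) ^ (2 ^ k + 1 - 2 ^ (i + 1))))
    have h3 := hwp (2 ^ k + 1 - 2 ^ (i + 1))
    rw [hg] at this
    rw [totalDegree_X_pow]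
    have h4 : 2 ^ (i + 1) = 2 ^ i * 2 := pow_succ 2 i
    omega

theorem natDegree_aeval_le {K : Type*} [Field K] (F : MvPolynomial (Fin 2) K)
    (f : Fin 2 → Polynomial K) (hf : ∀ i, (f i).natDegree ≤ 1) :
    (aeval f F).natDegree ≤ F.totalDegree := by
  simpa using aeval_natDegree_le F le_rfl f hf

theorem aeval_kasPoly {K B : Type*} [Field K] [CommRing B] [Algebra K B] (k : ℕ) (γ : K)
    (f : Fin 2 → B) : aeval f (kasPoly k γ) = kasP k (algebraMap K B γ) (f 0) (f 1) := by
  have := map_kasP (aeval f : MvPolynomial (Fin 2) K →ₐ[K] B).toRingHom k (C γ) (X 0) (X 1)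
  simpa [kasPoly] using this

theorem totalDegree_kasPoly {K : Type*} [Field K] (k : ℕ) (γ : K) :
    (kasPoly k γ).totalDegree = 2 ^ k + 1 := by
  refine le_antisymm (totalDegree_kasPoly_le k γ) ?_
  have h := natDegree_aeval_le (kasPoly k γ) ![Polynomial.X, 0] (by
    intro i; fin_cases i <;> simp)
  rw [aeval_kasPoly] at h
  simp only [Matrix.cons_val_zero, Matrix.cons_val_one, kasP_zero] at h
  rwa [Polynomial.natDegree_pow, Polynomial.algebraMap_eq, Polynomial.natDegree_X_add_C,
    mul_one] at h

theorem irreducible_kasPoly {K : Type*} [Field K] [CharP K 2] (k : ℕ) (hk : 2 ≤ k) (γ : K)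
    (h0 : γ ≠ 0) (h1 : γ ≠ 1) (hq : γ ^ 2 ^ k = γ) : Irreducible (kasPoly k γ) := by
  have hε : γ ^ 2 + γ ≠ 0 := by
    intro h
    have : γ * (γ - 1) = 0 := by grind
    rcases mul_eq_zero.1 this with h | h
    · exact h0 h
    · exact h1 (sub_eq_zero.1 h)
  have hεq : (γ ^ 2 + γ) ^ 2 ^ k = γ ^ 2 + γ := by
    rw [add_pow_char_pow, ← pow_mul, mul_comm, pow_mul, hq]
  obtain ⟨ρ, hρ1, hρ2⟩ : ∃ ρ : K, ρ ^ 2 = γ ^ 2 + γ ∧ ρ ^ 2 ^ k = ρ := by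
    refine ⟨(γ ^ 2 + γ) ^ 2 ^ (k - 1), ?_, ?_⟩
    · rw [← pow_mul, ← pow_succ, show k - 1 + 1 = k by omega, hεq]
    · rw [← pow_mul, mul_comm, pow_mul, hεq]
  have hρ0 : ρ ≠ 0 := by
    rintro rfl; apply hε; rw [← hρ1]; simp
  have hdeg := totalDegree_kasPoly k γ
  have hpos : 0 < 2 ^ k := by positivity
  have hne : kasPoly k γ ≠ 0 := by
    intro h; rw [h] at hdeg; simp at hdeg
  -- the two lines
  let f1 : Fin 2 → Polynomial K :=
    ![(Polynomial.X + 1) + Polynomial.C γ * Polynomial.X + Polynomial.C ρ * Polynomial.X,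
      Polynomial.X + 1]
  let f0 : Fin 2 → Polynomial K :=
    ![(Polynomial.X + 1) + Polynomial.C γ * Polynomial.X, Polynomial.X + 1]
  have e1 : aeval f1 (kasPoly k γ) = (Polynomial.C ρ * Polynomial.X) ^ (2 ^ k + 1) := by
    rw [aeval_kasPoly]
    exact kasP_line1 k (Polynomial.C γ) (Polynomial.C ρ) Polynomial.X
      (by rw [← Polynomial.C_pow, hρ1]; simp) (by rw [← Polynomial.C_pow, hρ2])
  have e0 : aeval f0 (kasPoly k γ) =
      (Polynomial.C γ ^ 2 + Polynomial.C γ) * (Polynomial.X ^ 2 ^ k + Polynomial.X) := by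
    rw [aeval_kasPoly]
    exact kasP_line0 k (Polynomial.C γ) Polynomial.X
  have hX1 : (Polynomial.X + 1 : Polynomial K).natDegree ≤ 1 := by
    rw [← Polynomial.C_1, Polynomial.natDegree_X_add_C]
  have hf1 : ∀ i, (f1 i).natDegree ≤ 1 := by
    intro i
    fin_cases i
    · simp only [f1]
      refine Polynomial.natDegree_add_le_of_degree_le
        (Polynomial.natDegree_add_le_of_degree_le hX1 ?_) ?_ <;>
      exact Polynomial.natDegree_C_mul_le _ _ |>.trans (by simp)
    · exact hX1
  -- values at the base point
  have hbase (F : MvPolynomial (Fin 2) K) :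
      (aeval f1 F).eval 0 = (aeval f0 F).eval 0 := by
    have a1 : ((Polynomial.aeval (0 : K)).comp (aeval f1)) F =
        ((Polynomial.aeval (0 : K)).comp (aeval f0)) F := by
      congr 1
      ext i
      fin_cases i <;> simp [f1, f0]
    simpa [Polynomial.coe_aeval_eq_eval] using a1
  have key (A B : MvPolynomial (Fin 2) K) (h : kasPoly k γ = A * B)
      (hA : ((aeval f1) A).eval 0 ≠ 0) : IsUnit A := by
    have hA0 : A ≠ 0 := by rintro rfl; simp at hne h; exact hne h
    have hB0 : B ≠ 0 := by rintro rfl; simp at hne h; exact hne h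
    have hA1 : (aeval f1) A ∣ Polynomial.X ^ (2 ^ k + 1) := by
      have : (aeval f1) A ∣ (Polynomial.C ρ * Polynomial.X) ^ (2 ^ k + 1) := by
        rw [← e1, h, map_mul]; exact dvd_mul_right _ _
      rw [mul_pow] at this
      refine (IsUnit.dvd_mul_left ?_).1 this
      exact (Polynomial.isUnit_C.2 hρ0.isUnit).pow _
    obtain ⟨i, hi, hi2⟩ := (dvd_prime_pow Polynomial.prime_X _).1 hA1
    have i0 : i = 0 := by
      by_contra hi0
      have : Polynomial.X ∣ (aeval f1) A :=
        (dvd_pow_self _ hi0).trans hi2.symm.dvd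
      rw [Polynomial.X_dvd_iff, Polynomial.coeff_zero_eq_eval_zero] at this
      exact hA this
    subst i0
    have hu : IsUnit ((aeval f1) A) := by
      rw [pow_zero] at hi2
      exact associated_one_iff_isUnit.1 hi2
    have hAd := Polynomial.natDegree_eq_zero_of_isUnit hu
    have hd1 : ((aeval f1) A * (aeval f1) B).natDegree = 2 ^ k + 1 := by
      rw [← map_mul, ← h, e1, Polynomial.natDegree_pow, Polynomial.natDegree_C_mul_X _ hρ0, mul_one]
    have hd2 := totalDegree_mul_of_isDomain hA0 hB0
    rw [← h, hdeg] at hd2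
    have hd3 := Polynomial.natDegree_mul_le (p := (aeval f1) A) (q := (aeval f1) B)
    have hd4 := natDegree_aeval_le B f1 hf1
    have : A.totalDegree = 0 := by omega
    rw [totalDegree_eq_zero_iff_eq_C] at this
    rw [this]
    refine IsUnit.map C (IsUnit.mk0 _ ?_)
    intro h; rw [h] at this; simp at this; exact hA0 this
  refine ⟨fun hu => ?_, fun A B h => ?_⟩
  · have := (isUnit_iff_totalDegree_of_isReduced.1 hu).2
    omega
  · by_cases hA : ((aeval f1) A).eval 0 = 0
    · right
      refine key B A (by rw [h, mul_comm]) fun hB => ?_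
      rw [hbase, ← Polynomial.coeff_zero_eq_eval_zero, ← Polynomial.X_dvd_iff] at hA hB
      have := mul_dvd_mul hA hB
      rw [← map_mul, ← h, e0, ← sq, Polynomial.X_pow_dvd_iff] at this
      have := this 1 (by norm_num)
      rw [← Polynomial.C_pow, ← Polynomial.C_add, Polynomial.coeff_C_mul, Polynomial.coeff_add,
        Polynomial.coeff_X_pow, Polynomial.coeff_X_one, if_neg] at this
      · simp at this; exact hε this
      · have : 2 ^ 2 ≤ 2 ^ k := Nat.pow_le_pow_right (by norm_num) hk
        omega
    · left; exact key A B h hA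

/-- the trace polynomial -/
def ktr {A : Type*} [CommRing A] (k : ℕ) (a : A) : A := ∑ i ∈ Finset.range k, a ^ 2 ^ i

theorem ktr_add {A : Type*} [CommRing A] [CharP A 2] (k : ℕ) (a b : A) :
    ktr k (a + b) = ktr k a + ktr k b := by
  simp [ktr, add_pow_char_pow, Finset.sum_add_distrib]

theorem ktr_sq {A : Type*} [CommRing A] [CharP A 2] (k : ℕ) (a : A) :
    ktr k (a ^ 2) = ktr k a + a ^ 2 ^ k + a := by
  induction k with
  | zero => simp [ktr, CharTwo.add_self_eq_zero]
  | succ n ih =>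
    unfold ktr at *
    rw [Finset.sum_range_succ, ih, Finset.sum_range_succ, ← pow_mul, ← pow_succ']
    generalize a ^ 2 ^ n = b
    generalize a ^ 2 ^ (n + 1) = c
    grind

theorem ktr_pow {A : Type*} [CommRing A] [CharP A 2] (k n : ℕ) (a : A) :
    ktr k (a ^ 2 ^ n) = ktr k a ^ 2 ^ n := by
  unfold ktr
  rw [sum_pow_char_pow]
  refine Finset.sum_congr rfl fun i _ => ?_
  rw [← pow_mul, ← pow_mul, mul_comm]

theorem ktr_artin {A : Type*} [CommRing A] [CharP A 2] (k : ℕ) (a : A) :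
    ktr k (a ^ 2 + a) = a ^ 2 ^ k + a := by
  rw [ktr_add, ktr_sq]
  grind

theorem ktr_self_sq {A : Type*} [CommRing A] [CharP A 2] (k : ℕ) (a : A) :
    ktr k a ^ 2 = ktr k a + a ^ 2 ^ k + a := by
  rw [← ktr_sq]
  simpa using (ktr_pow k 1 a).symm

theorem X_pow_card_eq_prod (K : Type*) [Field K] [Fintype K] :
    (Polynomial.X ^ Fintype.card K - Polynomial.X : Polynomial K) =
      ∏ a : K, (Polynomial.X - Polynomial.C a) := by
  have hc := Fintype.one_lt_card (α := K)
  have hm : (Polynomial.X ^ Fintype.card K - Polynomial.X : Polynomial K).Monic :=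
    Polynomial.monic_X_pow_sub (by
      rw [Polynomial.degree_X]; exact_mod_cast hc)
  have hr := FiniteField.roots_X_pow_card_sub_X K
  have := Polynomial.prod_multiset_X_sub_C_of_monic_of_roots_card_eq hm (by
    rw [hr, FiniteField.X_pow_card_sub_X_natDegree_eq K hc]; simp)
  rw [← this, hr]
  rfl

theorem exists_of_pow_eq {K L : Type*} [Field K] [Fintype K] [Field L] [Algebra K L] (a : L)
    (h : a ^ Fintype.card K = a) : ∃ b : K, a = algebraMap K L b := by
  have := congrArg (Polynomial.aeval a) (X_pow_card_eq_prod K)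
  simp [h, map_prod] at this
  obtain ⟨b, hb⟩ := Finset.prod_eq_zero_iff.1 this.symm
  exact ⟨b, sub_eq_zero.1 hb.2⟩

theorem al1 {L : Type*} [Field L] [CharP L 2] (ε Y Z y W w : L) (hε : ε ≠ 0) (hW : W ≠ 0)
    (hw : w ≠ 0)
    (h : (1 + ε * Y / (W * w)) ^ 2 = 1 + ε * Y / (W * w) + ε * Z / W ^ 2 + ε * y / w ^ 2) :
    Z * w ^ 2 + y * W ^ 2 = ε * Y ^ 2 + Y * (W * w) := by
  have h4 : ε * (Z * w ^ 2 + y * W ^ 2) = ε * (ε * Y ^ 2 + Y * (W * w)) := by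
    field_simp at h
    grind
  exact mul_left_cancel₀ hε h4

theorem al2 {A : Type*} [CommRing A] [CharP A 2] (ε Z y W w : A)
    (h : Z * w ^ 2 + y * W ^ 2 = ε * (Z + y) ^ 2 + (Z + y) * (W * w)) :
    (W * (y + 1) + w * (Z + 1)) ^ 2 * Z = (Z + y) ^ 2 * (W ^ 2 + ε * (Z + 1) ^ 2) +
      (Z + y) * (W * (y + 1) + w * (Z + 1)) * (W * (Z + 1)) := by
  grind

theorem al3 {A : Type*} [CommRing A] [CharP A 2] (M l R R' T : A)
    (h : M * R + l * R' + T = M * (R + R')) : T = R' * (M + l) := by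
  grind

theorem al4 {A : Type*} [CommRing A] [CharP A 2] (a Z y W w : A)
    (h : Z + y = a * (W * (y + 1) + w * (Z + 1))) :
    (Z + a * W) * (y + 1) = (y + a * w) * (Z + 1) := by
  grind

theorem al5 {A : Type*} [CommRing A] [CharP A 2] (R ε M l : A)
    (h : R ^ 2 * (M + l) ^ 2 = R * (M + l) + ε * M ^ 2 + ε * l ^ 2) :
    (M + l) * ((R ^ 2 + ε) * (M + l)) = (M + l) * R := by
  grind

theorem al6 {A : Type*} [CommRing A] [CharP A 2] (R ε M l : A)
    (h : (R ^ 2 + ε) * (M + l) = R) :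
    ((l * R) ^ 2 + l * R + ε * l ^ 2) * (M + l + 1) + M * l * (R ^ 2 + R + ε) = 0 := by
  grind

theorem al7 {A : Type*} [CommRing A] [CharP A 2] (x y x1 y1 x2 y2 : A) :
    (x2 * x * (y1 * (x1 + y1 + 1)) + y2 * y * (x1 * (x1 + y1 + 1)) + x1 * y1 * (x1 + y1 + 1) +
      (x2 + y2 + 1) * (x + y + 1) * (x1 * y1)) * (y1 + 1) =
    y1 * ((y2 + y1) * ((x1 + y1) * (y + 1) + (x + y) * (y1 + 1)) +
      (y1 + y) * ((x2 + y2) * (y1 + 1) + (x1 + y1) * (y2 + 1)) +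
      ((x1 + y1) * (y + 1) + (x + y) * (y1 + 1)) *
        ((x2 + y2) * (y1 + 1) + (x1 + y1) * (y2 + 1))) +
    (y2 + y1) * (y1 + y) * ((x1 + y1) * (x1 + 1)) := by
  grind

theorem field_key {K L : Type*} [Field K] [Fintype K] [Field L] [Algebra K L] [CharP L 2]
    (k : ℕ) (hcard : Fintype.card K = 2 ^ k) (γ : K) (h0 : γ ≠ 0) (h1 : γ ≠ 1)
    (x y : L)
    (hlin : ∀ a b c : K, algebraMap K L a * x + algebraMap K L b * y + algebraMap K L c = 0 →
      a = 0 ∧ b = 0 ∧ c = 0)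
    (hP : kasP k (algebraMap K L γ) x y = 0) (t : ℕ) (ht : t + 2 ^ k = (2 ^ k) * 2 ^ k + 1) :
    x ^ t + y ^ t + 1 + (x + y + 1) ^ t = 0 := by
  obtain ⟨g, hg⟩ : ∃ g, g = algebraMap K L γ := ⟨_, rfl⟩
  rw [← hg] at hP
  have hgq : g ^ 2 ^ k = g := by
    rw [hg, ← map_pow, ← hcard, FiniteField.pow_card]
  obtain ⟨q, hq⟩ : ∃ q, q = 2 ^ k := ⟨_, rfl⟩
  rw [← hq] at hgq hcard ht
  have addq (a b : L) : (a + b) ^ q = a ^ q + b ^ q := hq ▸ add_pow_char_pow a b 2 k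
  have hε : g ^ 2 + g ≠ 0 := by
    intro h
    have : g * (g - 1) = 0 := by grind
    rcases mul_eq_zero.1 this with h | h
    · rw [hg] at h; exact h0 ((map_eq_zero _).1 h)
    · rw [hg] at h
      exact h1 ((algebraMap K L).injective (by rw [map_one]; exact sub_eq_zero.1 h))
  obtain ⟨ε, hεd⟩ : ∃ ε, ε = g ^ 2 + g := ⟨_, rfl⟩
  rw [← hεd] at hε
  have hεq : ε ^ q = ε := by
    rw [hεd, addq, ← pow_mul, mul_comm, pow_mul, hgq]
  have hx : x ≠ 0 := fun h => by simpa using hlin 1 0 0 (by simp [h])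
  have hy : y ≠ 0 := fun h => by simpa using hlin 0 1 0 (by simp [h])
  have hxy : x + y + 1 ≠ 0 := fun h => by simpa using hlin 1 1 1 (by simp [h])
  have hu : y + 1 ≠ 0 := fun h => by simpa using hlin 0 1 1 (by simp [h])
  obtain ⟨u, hud⟩ : ∃ u, u = y + 1 := ⟨_, rfl⟩
  rw [← hud] at hu
  obtain ⟨w, hwd⟩ : ∃ w, w = x + y + g * u := ⟨_, rfl⟩
  have hw : w ≠ 0 := fun h => by
    have := hlin 1 (1 + γ) γ (by
      rw [map_one, map_add, map_one, ← hg]; rw [← h, hwd, hud]; ring)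
    simpa using this.1
  have huq : u ^ q = y ^ q + 1 := by rw [hud, addq, one_pow]
  have hwq : w ^ q = x ^ q + y ^ q + g * u ^ q := by rw [hwd, addq, addq, mul_pow, hgq]
  obtain ⟨Y, hY⟩ : ∃ Y, Y = y ^ q + y := ⟨_, rfl⟩
  obtain ⟨D, hD⟩ : ∃ D, D = w ^ q * u + w * u ^ q := ⟨_, rfl⟩
  have hD0 : D ≠ 0 := by
    intro h
    have : (w / u) ^ q = w / u := by
      rw [div_pow, div_eq_div_iff (pow_ne_zero _ hu) hu]
      exact CharTwo.add_eq_zero.1 (hD.symm.trans h)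
    rw [← hcard] at this
    obtain ⟨b, hb⟩ := exists_of_pow_eq _ this
    rw [div_eq_iff hu] at hb
    have := hlin 1 (1 + γ + b) (γ + b) (by
      rw [map_one, map_add, map_add, map_add, map_one, ← hg]
      have h2 := CharTwo.add_eq_zero.2 hb
      rw [hwd, hud] at h2
      rw [← h2]; ring)
    simpa using this.1
  -- first relation
  have r1 : y ^ q * w ^ 2 + y * (w ^ q) ^ 2 = ε * Y ^ 2 + Y * (w ^ q * w) := by
    have hT : 1 + ε * Y / w ^ (q + 1) + ktr k (ε * y / w ^ 2) = 0 := by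
      have : w ^ (q + 1) * (1 + ε * Y / w ^ (q + 1) + ktr k (ε * y / w ^ 2)) = 0 := by
        rw [← hP, kasP, ← hεd, ← hud, ← hwd, ← hq, ← hY, mul_add, mul_add, mul_one, mul_div_cancel₀ _ (pow_ne_zero _ hw), ktr,
          Finset.mul_sum]
        congr 1
        refine Finset.sum_congr rfl fun i hi => ?_
        have hi' := pow_le_aux hi
        rw [← hq] at hi'
        have : w ^ (q + 1) = w ^ (q + 1 - 2 ^ (i + 1)) * (w ^ 2) ^ 2 ^ i := by
          rw [← pow_mul, ← pow_add, ← pow_succ']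
          congr 1; omega
        rw [this, div_pow, mul_pow]
        have : (w ^ 2) ^ 2 ^ i ≠ 0 := pow_ne_zero _ (pow_ne_zero _ hw)
        field_simp
      exact (mul_eq_zero.1 this).resolve_left (pow_ne_zero _ hw)
    have h2 := ktr_self_sq k (ε * y / w ^ 2)
    have h3 : ktr k (ε * y / w ^ 2) = 1 + ε * Y / w ^ (q + 1) :=
      (CharTwo.add_eq_zero.1 hT).symm
    rw [h3, div_pow (ε * y), mul_pow ε y, ← hq, hεq, ← pow_mul, mul_comm 2, pow_mul,
      pow_succ w q] at h2
    exact al1 ε Y (y ^ q) y (w ^ q) w hε (pow_ne_zero _ hw) hw h2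
  -- lam
  obtain ⟨lam, hlam⟩ : ∃ lam, lam = Y / D := ⟨_, rfl⟩
  have hYD : Y = lam * D := by rw [hlam]; field_simp
  have r2 : y ^ q = lam ^ 2 * ((w ^ q) ^ 2 + ε * (u ^ q) ^ 2) + lam * w ^ q * u ^ q := by
    have : D ^ 2 * y ^ q = Y ^ 2 * ((w ^ q) ^ 2 + ε * (u ^ q) ^ 2) + Y * D * (w ^ q * u ^ q) := by
      rw [hY] at r1
      rw [hD, huq, hY, hud]
      exact al2 _ _ _ _ _ r1
    have h2 : D ^ 2 * y ^ q =
        D ^ 2 * (lam ^ 2 * ((w ^ q) ^ 2 + ε * (u ^ q) ^ 2) + lam * w ^ q * u ^ q) := by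
      rw [this, hYD]; ring
    exact mul_left_cancel₀ (pow_ne_zero _ hD0) h2
  obtain ⟨ρ, hρ⟩ : ∃ ρ, ρ = w / u := ⟨_, rfl⟩
  have huq0 : u ^ q ≠ 0 := pow_ne_zero _ hu
  have hwρ : w = ρ * u := by rw [hρ]; field_simp
  have hwρq : w ^ q = ρ ^ q * u ^ q := by rw [hwρ, mul_pow]
  have r2' : (y / u ^ 2) ^ q = ((lam * ρ ^ q) ^ 2 + lam * ρ ^ q) + ε * lam ^ 2 := by
    rw [div_pow, r2, hwρq, ← pow_mul u 2 q, mul_comm 2, pow_mul]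
    field_simp
    ring
  have hc : ktr k (y / u ^ 2) = lam * (ρ ^ q + ρ) := by
    have : y / u ^ 2 = (y / u) ^ 2 + y / u := by
      field_simp; rw [hud]; grind
    rw [this, ktr_artin, ← hq]
    have e1 : Y / (u ^ q * u) = lam * (ρ ^ q + ρ) := by
      rw [hYD, hD, hwρq, div_eq_iff (mul_ne_zero huq0 hu)]
      linear_combination (lam * u ^ q) * hwρ
    rw [← e1, div_pow]
    field_simp
    rw [huq, hY, hud]; grind
  have r3 : ktr k (ε * lam ^ 2) = ρ ^ q * (lam ^ q + lam) := by
    have h := ktr_pow k k (y / u ^ 2)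
    rw [hc, ← hq, r2', ktr_add, ktr_artin, mul_pow, ← hq, mul_pow, addq] at h
    exact al3 _ _ _ _ _ h
  have hμ : lam ^ q + lam ≠ 0 := by
    intro h
    have : lam ^ q = lam := CharTwo.add_eq_zero.1 h
    rw [← hcard] at this
    obtain ⟨a, ha⟩ := exists_of_pow_eq _ this
    have haq : (algebraMap K L a) ^ q = algebraMap K L a := by
      rw [← map_pow, ← hcard, FiniteField.pow_card]
    have h5 : ((y + algebraMap K L a * w) / u) ^ q = (y + algebraMap K L a * w) / u := by
      rw [div_pow, div_eq_div_iff huq0 hu, addq, mul_pow, haq]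
      rw [ha] at hYD
      rw [hY, hD, huq, hud] at hYD
      rw [huq, hud]
      exact al4 _ _ _ _ _ hYD
    rw [← hcard] at h5
    obtain ⟨b, hb⟩ := exists_of_pow_eq _ h5
    rw [div_eq_iff hu] at hb
    have h6 := hlin a (1 + a + a * γ + b) (a * γ + b) (by
      simp only [map_add, map_mul, map_one, ← hg]
      have h2 := CharTwo.add_eq_zero.2 hb
      rw [hwd, hud] at h2
      rw [← h2]; ring)
    obtain ⟨ha0, hb0, hc0⟩ := h6
    simp [ha0] at hc0
    simp [ha0, hc0] at hb0
  have r4 : ((ρ ^ q) ^ 2 + ε) * (lam ^ q + lam) = ρ ^ q := by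
    have h := ktr_self_sq k (ε * lam ^ 2)
    rw [r3, ← hq, mul_pow, mul_pow ε, hεq, ← pow_mul lam 2 q, mul_comm 2, pow_mul] at h
    exact mul_left_cancel₀ hμ (al5 _ _ _ _ h)
  have r5 : (y / u ^ 2) ^ q * (lam ^ q + lam + 1) +
      lam ^ q * lam * ((ρ ^ q) ^ 2 + ρ ^ q + ε) = 0 := by
    rw [r2']
    exact al6 _ _ _ _ r4
  -- back to the equation
  have r6 : y ^ q * (Y ^ q * D + Y * D ^ q + D * D ^ q) +
      Y ^ q * Y * ((x ^ q + y ^ q) * (x ^ q + 1)) = 0 := by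
    have e1 : y ^ q = (y / u ^ 2) ^ q * (u ^ q) ^ 2 := by
      rw [div_pow, ← pow_mul u 2 q, mul_comm 2, pow_mul]; field_simp
    have e2 : (x ^ q + y ^ q) * (x ^ q + 1) = ((ρ ^ q) ^ 2 + ρ ^ q + ε) * (u ^ q) ^ 2 := by
      have e3 : x ^ q + y ^ q = (ρ ^ q + g) * u ^ q := by
        have e4 := hwq
        rw [hwρq] at e4
        rw [add_mul, e4, add_assoc, CharTwo.add_self_eq_zero, add_zero]
      have e5 : x ^ q + 1 = (ρ ^ q + g + 1) * u ^ q := by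
        rw [add_mul, ← e3, one_mul, huq]
        generalize x ^ q = a
        generalize y ^ q = b
        grind
      rw [e3, e5, hεd]
      generalize ρ ^ q = a
      generalize u ^ q = b
      grind
    rw [e2, e1, hYD, mul_pow]
    linear_combination (D * D ^ q * (u ^ q) ^ 2) * r5
  have hDv : D = (x ^ q + y ^ q) * (y + 1) + (x + y) * (y ^ q + 1) := by
    rw [hD, hwq, hwd, huq, hud]
    generalize x ^ q = a
    generalize y ^ q = b
    grind
  have hDq : D ^ q = ((x ^ q) ^ q + (y ^ q) ^ q) * (y ^ q + 1) +
      (x ^ q + y ^ q) * ((y ^ q) ^ q + 1) := by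
    rw [hDv]; simp only [addq, mul_pow, one_pow]
  have hYq : Y ^ q = (y ^ q) ^ q + y ^ q := by rw [hY, addq]
  have hall := al7 x y (x ^ q) (y ^ q) ((x ^ q) ^ q) ((y ^ q) ^ q)
  rw [← hDq, ← hYq, ← hDv, ← hY, r6, ← huq] at hall
  have hall' := (mul_eq_zero.1 hall).resolve_right huq0
  have hpt (a : L) : a ^ t * a ^ q = (a ^ q) ^ q * a := by
    rw [← pow_add, ht, pow_succ, pow_mul]
  have hsq : (x + y + 1) ^ q = x ^ q + y ^ q + 1 := by rw [addq, addq, one_pow]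
  have hsqq : ((x + y + 1) ^ q) ^ q = (x ^ q) ^ q + (y ^ q) ^ q + 1 := by
    rw [hsq, addq, addq, one_pow]
  have hfin : (x ^ t + y ^ t + 1 + (x + y + 1) ^ t) * (x ^ q * y ^ q * (x + y + 1) ^ q) = 0 := by
    have p1 := hpt x
    have p2 := hpt y
    have p3 := hpt (x + y + 1)
    rw [← hall', ← hsqq, ← hsq]
    linear_combination (y ^ q * (x + y + 1) ^ q) * p1 + (x ^ q * (x + y + 1) ^ q) * p2 +
      (x ^ q * y ^ q) * p3
  exact (mul_eq_zero.1 hfin).resolve_right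
    (mul_ne_zero (mul_ne_zero (pow_ne_zero _ hx) (pow_ne_zero _ hy)) (pow_ne_zero _ hxy))

theorem lin_ne_zero {K : Type*} [Field K] (a b c : K)
    (h : (C a * X 0 + C b * X 1 + C c : MvPolynomial (Fin 2) K) = 0) :
    a = 0 ∧ b = 0 ∧ c = 0 := by
  have e0 := congrArg (eval ![(0 : K), 0]) h
  have e1 := congrArg (eval ![(1 : K), 0]) h
  have e2 := congrArg (eval ![(0 : K), 1]) h
  simp at e0 e1 e2
  subst e0
  simp at e1 e2
  exact ⟨e1, e2, rfl⟩

theorem kasPoly_not_dvd_lin {K : Type*} [Field K] (k : ℕ) (γ a b c : K)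
    (h : kasPoly k γ ∣ C a * X 0 + C b * X 1 + C c) : a = 0 ∧ b = 0 ∧ c = 0 := by
  by_contra hne
  have h1 := totalDegree_le_of_dvd_of_isDomain h (fun h0 => hne (lin_ne_zero _ _ _ h0))
  rw [totalDegree_kasPoly] at h1
  have h2 := totalDegree_lin a b c
  have hpos : 0 < 2 ^ k := by positivity
  omega

theorem kasPoly_dvd {K : Type*} [Field K] [Fintype K] [CharP K 2]
    (k : ℕ) (hk : 2 ≤ k) (hcard : Fintype.card K = 2 ^ k) (γ : K) (h0 : γ ≠ 0) (h1 : γ ≠ 1)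
    (t : ℕ) (ht : t + 2 ^ k = (2 ^ k) * 2 ^ k + 1) :
    kasPoly k γ ∣ (X 0 ^ t + X 1 ^ t + 1 + (X 0 + X 1 + 1) ^ t : MvPolynomial (Fin 2) K) := by
  have hirr := irreducible_kasPoly k hk γ h0 h1 (by rw [← hcard, FiniteField.pow_card])
  let I : Ideal (MvPolynomial (Fin 2) K) := Ideal.span {kasPoly k γ}
  have hI : I.IsPrime := (Ideal.span_singleton_prime hirr.ne_zero).2 hirr.prime
  let R := MvPolynomial (Fin 2) K ⧸ I
  let L := FractionRing R
  let f : MvPolynomial (Fin 2) K →ₐ[K] L :=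
    (IsScalarTower.toAlgHom K R L).comp (Ideal.Quotient.mkₐ K I)
  have hf (F : MvPolynomial (Fin 2) K) : f F = 0 ↔ kasPoly k γ ∣ F := by
    rw [← Ideal.mem_span_singleton, ← Ideal.Quotient.eq_zero_iff_mem]
    exact (FaithfulSMul.algebraMap_eq_zero_iff R L)
  have : CharP L 2 := charP_of_injective_algebraMap (algebraMap K L).injective 2
  rw [← hf]
  have hC (a : K) : f (C a) = algebraMap K L a := f.commutes a
  have key := field_key (K := K) (L := L) k hcard γ h0 h1 (f (X 0)) (f (X 1)) (by
    intro a b c h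
    apply kasPoly_not_dvd_lin k γ a b c
    rw [← hf]
    simpa [hC] using h) (by
    rw [← hC]
    have := map_kasP f.toRingHom k (C γ) (X 0) (X 1)
    refine this.symm.trans ?_
    exact (hf _).2 dvd_rfl) t ht
  simpa using key

theorem one_le_deg {K : Type*} [Field K] (F : MvPolynomial (Fin 2) K) (p q : Fin 2 → K)
    (h : eval p F ≠ eval q F) : 1 ≤ F.totalDegree := by
  by_contra h0
  have : F.totalDegree = 0 := by omega
  rw [totalDegree_eq_zero_iff_eq_C] at this
  rw [this] at h
  simp at h

theorem totalDegree_G {K : Type*} [Field K] (t : ℕ) :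
    (X 0 ^ t + X 1 ^ t + 1 + (X 0 + X 1 + 1) ^ t : MvPolynomial (Fin 2) K).totalDegree ≤ t := by
  have hw : (X 0 + X 1 + 1 : MvPolynomial (Fin 2) K).totalDegree ≤ 1 := by
    simpa using totalDegree_lin (1 : K) 1 1
  refine (totalDegree_add _ _).trans (max_le ((totalDegree_add _ _).trans
    (max_le ((totalDegree_add _ _).trans (max_le ?_ ?_)) ?_)) ?_)
  · rw [totalDegree_X_pow]
  · rw [totalDegree_X_pow]
  · simp
  · exact (totalDegree_pow _ _).trans (by nlinarith)

theorem al8 {A : Type*} [CommRing A] [CharP A 2] (x x1 x2 : A) :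
    x2 * x * (x1 + 1) + x1 * (x1 + 1) + (x2 + 1) * (x + 1) * x1 = (x2 + x1) * (x1 + x) := by
  grind

/-- the restriction to y = 0 -/
theorem G_zero {A : Type*} [CommRing A] [CharP A 2] (k t : ℕ)
    (ht : t + 2 ^ k = (2 ^ k) * 2 ^ k + 1) (x : A) :
    (x ^ t + 1 + (x + 1) ^ t) * (x ^ 2 ^ k * (x + 1) ^ 2 ^ k) = (x ^ 2 ^ k + x) ^ (2 ^ k + 1) := by
  obtain ⟨q, hq⟩ : ∃ q, q = 2 ^ k := ⟨_, rfl⟩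
  have addq (a b : A) : (a + b) ^ q = a ^ q + b ^ q := hq ▸ add_pow_char_pow a b 2 k
  rw [← hq] at ht ⊢
  have hpt (a : A) : a ^ t * a ^ q = (a ^ q) ^ q * a := by
    rw [← pow_add, ht, pow_succ, pow_mul]
  have p1 := hpt x
  have p2 := hpt (x + 1)
  have e1 : (x + 1) ^ q = x ^ q + 1 := by rw [addq, one_pow]
  have e2 : ((x + 1) ^ q) ^ q = (x ^ q) ^ q + 1 := by rw [e1, addq, one_pow]
  rw [pow_succ, addq (x ^ q) x, ← al8, ← e2, ← e1]
  linear_combination ((x + 1) ^ q) * p1 + (x ^ q) * p2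

theorem main_aux {K : Type*} [Field K] [Fintype K] [DecidableEq K] [CharP K 2]
    (k : ℕ) (hk : 2 ≤ k) (hcard : Fintype.card K = 2 ^ k)
    (t : ℕ) (ht : t + 2 ^ k = (2 ^ k) * 2 ^ k + 1)
    (phi : MvPolynomial (Fin 2) K)
    (hphi : phi * ((X 0 + X 1) * (X 0 + 1) * (X 1 + 1)) =
      X 0 ^ t + X 1 ^ t + 1 + (X 0 + X 1 + 1) ^ t) :
    phi = ∏ α ∈ Finset.univ.filter (fun α : K => α ≠ 0 ∧ α ≠ 1), kasPoly k α := by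
  set s := Finset.univ.filter (fun α : K => α ≠ 0 ∧ α ≠ 1) with hs
  have hirr (α : K) (h0 : α ≠ 0) (h1 : α ≠ 1) := irreducible_kasPoly k hk α h0 h1
    (by rw [← hcard, FiniteField.pow_card])
  have hdvd : ∀ α ∈ s, kasPoly k α ∣ phi := by
    intro α hα
    simp only [hs, Finset.mem_filter, Finset.mem_univ, true_and] at hα
    have h := kasPoly_dvd k hk hcard α hα.1 hα.2 t ht
    rw [← hphi] at h
    have hp := (hirr α hα.1 hα.2).prime
    rcases hp.dvd_or_dvd h with h | h
    · exact h
    exfalso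
    rcases hp.dvd_or_dvd h with h | h
    · rcases hp.dvd_or_dvd h with h | h
      · simpa using kasPoly_not_dvd_lin k α 1 1 0 (by simpa using h)
      · simpa using kasPoly_not_dvd_lin k α 1 0 1 (by simpa using h)
    · simpa using kasPoly_not_dvd_lin k α 0 1 1 (by simpa using h)
  let r : MvPolynomial (Fin 2) K →ₐ[K] Polynomial K := aeval ![Polynomial.X, 0]
  have hr (α : K) : r (kasPoly k α) = (Polynomial.X + Polynomial.C α) ^ (2 ^ k + 1) := by
    simp only [r]
    rw [aeval_kasPoly]
    exact kasP_zero _ _ _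
  have hcop : (s : Set K).Pairwise (Function.onFun IsRelPrime (kasPoly k)) := by
    intro α hα β hβ hne
    simp only [hs, Finset.coe_filter, Finset.mem_univ, true_and, Set.mem_ofPred_eq] at hα hβ
    refine ((hirr α hα.1 hα.2).isRelPrime_iff_not_dvd).2 fun h => ?_
    have h2 : r (kasPoly k α) ∣ r (kasPoly k β) := map_dvd r h
    rw [hr, hr] at h2
    have h3 : (Polynomial.X + Polynomial.C α) ∣ (Polynomial.X + Polynomial.C β) ^ (2 ^ k + 1) :=
      (dvd_pow_self _ (by omega)).trans h2
    obtain ⟨c, hc⟩ := h3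
    have h4 := congrArg (Polynomial.eval α) hc
    simp [CharTwo.add_self_eq_zero] at h4
    exact hne (CharTwo.add_eq_zero.1 h4)
  obtain ⟨Q, hQ⟩ := Finset.prod_dvd_of_isRelPrime hcop hdvd
  -- restriction
  have hprod : (Polynomial.X ^ 2 ^ k + Polynomial.X : Polynomial K) =
      (Polynomial.X * (Polynomial.X + 1)) * ∏ α ∈ s, (Polynomial.X + Polynomial.C α) := by
    have h := X_pow_card_eq_prod K
    simp only [CharTwo.sub_eq_add, hcard] at h
    rw [h]
    have hs' : s = (Finset.univ.erase 0).erase 1 := by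
      ext a; simp [hs]; tauto
    rw [hs', ← Finset.mul_prod_erase _ _ (Finset.mem_univ (0 : K)),
      ← Finset.mul_prod_erase _ _ (show (1 : K) ∈ Finset.univ.erase 0 by simp)]
    simp [mul_assoc]
  have hXX : (Polynomial.X * (Polynomial.X + 1) : Polynomial K) ≠ 0 :=
    mul_ne_zero Polynomial.X_ne_zero (Polynomial.X_add_C_ne_zero (1 : K))
  have hPi : r (∏ α ∈ s, kasPoly k α) =
      (∏ α ∈ s, (Polynomial.X + Polynomial.C α)) ^ (2 ^ k + 1) := by
    rw [map_prod, ← Finset.prod_pow]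
    exact Finset.prod_congr rfl fun α _ => hr α
  have ht0 : t ≠ 0 := by rintro rfl; nlinarith [Nat.one_le_two_pow (n := k)]
  have hrphi : r phi = r (∏ α ∈ s, kasPoly k α) := by
    have h := congrArg r hphi
    simp [r, ht0] at h
    have h2 := G_zero k t ht (Polynomial.X : Polynomial K)
    rw [← h, hprod, mul_pow _ _ (2 ^ k + 1), ← hPi] at h2
    refine mul_left_cancel₀ (pow_ne_zero (2 ^ k + 1) hXX) ?_
    rw [← h2, pow_succ, mul_pow]
    simp only [r]
    ring
  have hne : r (∏ α ∈ s, kasPoly k α) ≠ 0 := by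
    rw [hPi]
    exact pow_ne_zero _ (Finset.prod_ne_zero_iff.2 fun α _ => Polynomial.X_add_C_ne_zero α)
  have hrQ : r Q = 1 := by
    have h := hrphi
    rw [hQ, map_mul] at h
    exact mul_left_cancel₀ hne (by rw [h, mul_one])
  have hQ0 : Q ≠ 0 := by rintro rfl; simp at hrQ
  have hPi0 : ∏ α ∈ s, kasPoly k α ≠ 0 := fun h => hne (by rw [h, map_zero])
  -- degrees
  have hcs : s.card + 2 = 2 ^ k := by
    have hs' : s = (Finset.univ.erase 0).erase 1 := by
      ext a; simp [hs]; tauto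
    rw [hs', Finset.card_erase_of_mem (by simp), Finset.card_erase_of_mem (by simp),
      Finset.card_univ, hcard]
    have : 2 ^ 2 ≤ 2 ^ k := Nat.pow_le_pow_right (by norm_num) hk
    omega
  have hdPi : (∏ α ∈ s, kasPoly k α).totalDegree = s.card * (2 ^ k + 1) := by
    have hgen : ∀ S : Finset K, (∏ α ∈ S, kasPoly k α) ≠ 0 ∧
        (∏ α ∈ S, kasPoly k α).totalDegree = S.card * (2 ^ k + 1) := by
      intro S
      induction S using Finset.induction_on with
      | empty => simp
      | insert a S ha ih =>
        have hn : kasPoly k a ≠ 0 := by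
          intro h
          have := totalDegree_kasPoly k a
          rw [h] at this; simp at this
        rw [Finset.prod_insert ha, Finset.card_insert_of_notMem ha]
        refine ⟨mul_ne_zero hn ih.1, ?_⟩
        rw [totalDegree_mul_of_isDomain hn ih.1, ih.2, totalDegree_kasPoly]
        ring
    exact (hgen s).2
  have l1 : 1 ≤ (X 0 + X 1 : MvPolynomial (Fin 2) K).totalDegree :=
    one_le_deg _ ![1, 0] ![0, 0] (by simp)
  have l2 : 1 ≤ (X 0 + 1 : MvPolynomial (Fin 2) K).totalDegree :=
    one_le_deg _ ![1, 0] ![0, 0] (by simp)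
  have l3 : 1 ≤ (X 1 + 1 : MvPolynomial (Fin 2) K).totalDegree :=
    one_le_deg _ ![0, 1] ![0, 0] (by simp)
  have n1 : (X 0 + X 1 : MvPolynomial (Fin 2) K) ≠ 0 := by
    intro h; rw [h] at l1; simp at l1
  have n2 : (X 0 + 1 : MvPolynomial (Fin 2) K) ≠ 0 := by
    intro h; rw [h] at l2; simp at l2
  have n3 : (X 1 + 1 : MvPolynomial (Fin 2) K) ≠ 0 := by
    intro h; rw [h] at l3; simp at l3
  have hd := totalDegree_G (K := K) t
  rw [← hphi, hQ, totalDegree_mul_of_isDomain (mul_ne_zero hPi0 hQ0)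
    (mul_ne_zero (mul_ne_zero n1 n2) n3), totalDegree_mul_of_isDomain hPi0 hQ0,
    totalDegree_mul_of_isDomain (mul_ne_zero n1 n2) n3, totalDegree_mul_of_isDomain n1 n2,
    hdPi] at hd
  have hQd : Q.totalDegree = 0 := by
    rw [← hcs] at hd ht
    nlinarith
  rw [totalDegree_eq_zero_iff_eq_C] at hQd
  have hQ1 : Q = 1 := by
    rw [hQd] at hrQ ⊢
    simp only [r, aeval_C, Polynomial.algebraMap_eq] at hrQ
    rw [← Polynomial.C_1, Polynomial.C_inj] at hrQ
    rw [hrQ, C_1]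
  rw [hQ, hQ1, mul_one]

/-- Janwa–Wilson factorization: For the Kasami–Welch number
`t = 2^(2k) - 2^k + 1` (k ≥ 2), `φ_t(x,y)` — the (unique) quotient of
`x^t + y^t + 1 + (x+y+1)^t` by `(x+y)(x+1)(y+1)`, here taken in `F_{2^k}[x,y]` — factors as
`∏_{α ∈ F_{2^k} \ F_2} P_α(x,y)` where each `P_α ∈ F_{2^k}[x,y]` is absolutely irreducible of
total degree `2^k + 1` and satisfies `P_α(x,0) = (x+α)^(2^k+1)`. -/
theorem kasami_phi_factorization (k : ℕ) (hk : 2 ≤ k) (t : ℕ)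
    (ht : t = 2 ^ (2 * k) - 2 ^ k + 1)
    (phi : MvPolynomial (Fin 2) (GaloisField 2 k))
    (hphi : phi * ((X 0 + X 1) * (X 0 + 1) * (X 1 + 1)) =
      X 0 ^ t + X 1 ^ t + 1 + (X 0 + X 1 + 1) ^ t) :
    ∃ P : GaloisField 2 k → MvPolynomial (Fin 2) (GaloisField 2 k),
      phi = (∏ᶠ (α : GaloisField 2 k) (_ : α ≠ 0 ∧ α ≠ 1), P α) ∧
      ∀ α : GaloisField 2 k, α ≠ 0 → α ≠ 1 →
        Irreducible (MvPolynomial.map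
          (algebraMap (GaloisField 2 k) (AlgebraicClosure (GaloisField 2 k))) (P α)) ∧
        (P α).totalDegree = 2 ^ k + 1 ∧
        (MvPolynomial.aeval ![X 0, 0] (P α) : MvPolynomial (Fin 2) (GaloisField 2 k)) =
          (X 0 + C α) ^ (2 ^ k + 1) := by
  classical
  have : Fintype (GaloisField 2 k) := Fintype.ofFinite _
  have hcard : Fintype.card (GaloisField 2 k) = 2 ^ k := by
    rw [← Nat.card_eq_fintype_card, GaloisField.card 2 k (by omega)]
  have ht' : t + 2 ^ k = 2 ^ k * 2 ^ k + 1 := by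
    have h1 : 2 ^ (2 * k) = 2 ^ k * 2 ^ k := by rw [two_mul, pow_add]
    have h2 : 2 ^ k ≤ 2 ^ k * 2 ^ k := Nat.le_mul_of_pos_left _ (by positivity)
    rw [ht, h1]; omega
  refine ⟨kasPoly k, ?_, ?_⟩
  · rw [main_aux k hk hcard t ht' phi hphi]
    symm
    refine finprod_cond_eq_prod_of_cond_iff _ ?_
    intro x _; simp
  · intro α h0 h1
    have : CharP (AlgebraicClosure (GaloisField 2 k)) 2 :=
      charP_of_injective_algebraMap
        (algebraMap (GaloisField 2 k) (AlgebraicClosure (GaloisField 2 k))).injective 2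
    refine ⟨?_, totalDegree_kasPoly k α, ?_⟩
    · have h := irreducible_kasPoly k hk
        (algebraMap (GaloisField 2 k) (AlgebraicClosure (GaloisField 2 k)) α)
        (by simpa using h0) (by simpa using h1)
        (by rw [← map_pow, ← hcard, FiniteField.pow_card])
      have e := map_kasP (MvPolynomial.map (σ := Fin 2) (algebraMap (GaloisField 2 k)
        (AlgebraicClosure (GaloisField 2 k)))) k (C α) (X 0) (X 1)
      rw [map_C, map_X, map_X] at e
      unfold kasPoly at h ⊢
      rw [e]
      exact h
    · rw [aeval_kasPoly]
      exact kasP_zero _ _ _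
end

section
/- Let n, k ≥ 1 be integers with gcd(k, n) = 1. Then the Gold function f(x) = x^{2^k + 1} is APN on F_{2^n}, and the Kasami–Welch function g(x) = x^{2^{2k} − 2^k + 1} is APN on F_{2^n}. -/
section Aux
variable {K : Type} [Field K] [CharP K 2]

theorem aux_two : (2 : K) = 0 := by
  have := CharP.cast_eq_zero K 2
  exact_mod_cast this

theorem aux_add_eq_zero {a b : K} (h : a + b = 0) : a = b := by
  have := aux_two (K := K)
  linear_combination h - b * this

/-- The core step: after normalising, two solutions coincide up to adding `1`. -/
theorem aux_core (φ : K →+* K) (hφ : ∀ x, φ x = x → x = 0 ∨ x = 1) (x₁ x₂ c z₁ z₂ : K)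
    (hz₁ : z₁ = φ x₁ + x₁) (hz₂ : z₂ = φ x₂ + x₂) (h₁ : z₁ ≠ 0) (h₂ : z₂ ≠ 0) (hc : c ≠ 0)
    (e₁ : c * (z₁ * φ z₁) = φ (x₁ ^ 2 + x₁)) (e₂ : c * (z₂ * φ z₂) = φ (x₂ ^ 2 + x₂))
    (he : c * (z₁ * φ z₂ + φ z₁ * z₂) = φ (x₁ + x₂)) : z₁ = z₂ := by
  have two := aux_two (K := K)
  obtain ⟨t, rfl⟩ : ∃ t, z₂ = t * z₁ := ⟨z₂ / z₁, by field_simp⟩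
  have hφz : φ z₁ ≠ 0 := by simpa using h₁
  have ht0 : t ≠ 0 := by rintro rfl; simp at h₂
  simp only [map_mul, map_add, map_pow] at e₁ e₂ he
  obtain ⟨A, hA⟩ : ∃ A, A = c * (z₁ * φ z₁) := ⟨_, rfl⟩
  have hA0 : A ≠ 0 := by rw [hA]; positivity
  obtain ⟨s, hs⟩ : ∃ s, s = 1 + t := ⟨_, rfl⟩
  have hS : φ s = 1 + φ t := by rw [hs]; simp
  obtain ⟨S, hSS⟩ : ∃ S, S = φ s := ⟨_, rfl⟩
  by_cases hsS : s + S = 0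
  · have : φ s = s := by rw [← hSS]; exact (aux_add_eq_zero hsS).symm
    rcases hφ s this with h | h
    · have : 1 = t := aux_add_eq_zero (by rw [← hs, h])
      rw [← this]; simp
    · exfalso; apply ht0; linear_combination h - hs
  · obtain ⟨u, hu⟩ : ∃ u, u = x₁ + x₂ := ⟨_, rfl⟩
    have hφu' : φ u = φ x₁ + φ x₂ := by rw [hu]; simp
    have hT : φ t = S - 1 := by rw [hSS, hS]; ring
    have ht : t = s - 1 := by rw [hs]; ring
    rw [hT, ht] at he e₂
    have hφu : φ u = A * (s + S) := by
      linear_combination hφu' - he - (s+S)* hA + c * z₁ * φ z₁ * ( -1) * two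
    have hq : (φ u) ^ 2 + φ u = A * (s + S + s * S) := by
      rw [hφu']
      linear_combination -e₁ - e₂ + φ x₁ * φ x₂ * two - (s+S+s*S) * hA
        + c * z₁ * φ z₁ * (1 - s - S) * two
    have hA2 : A * (s + S) ^ 2 = s * S := by
      apply mul_left_cancel₀ hA0
      rw [hφu] at hq
      linear_combination hq
    obtain ⟨p, hp⟩ : ∃ p, s = p * (s + S) := ⟨s / (s + S), by field_simp⟩
    have hp' : S = (p + 1) * (s + S) := by linear_combination hp - s * two
    have hAp : A = p * (p + 1) := by
      apply mul_right_cancel₀ (pow_ne_zero 2 hsS)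
      rw [hA2]
      nth_rewrite 1 [hp]
      nth_rewrite 2 [hp']
      ring
    have hX : (p + φ x₁) * (p + φ x₁ + 1) = 0 := by
      linear_combination -hAp + hA + e₁ + (p * φ x₁ + φ x₁^2 + φ x₁ ) * two
    obtain ⟨δ, hδ, hδ'⟩ : ∃ δ : K, φ δ = δ ∧ p = φ x₁ + δ := by
      rcases mul_eq_zero.1 hX with h | h
      · exact ⟨0, by simp, by rw [aux_add_eq_zero h]; simp⟩
      · refine ⟨1, by simp, ?_⟩
        linear_combination h - (φ x₁ + 1) * two
    have f1 : φ u = (p + 1) * s := by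
      rw [hφu, hAp]; linear_combination -(p+1) * hp
    have f2 : φ u = p * S := by
      rw [hφu, hAp]; linear_combination -p * hp'
    have hw : z₁ * s = φ u + u := by
      rw [hφu', hu, hs]
      linear_combination hz₁ + hz₂
    have f3 : u = (x₁ + δ + 1) * s := by
      rw [f1, hz₁] at hw
      linear_combination (-1) * hw - hδ' * s - (δ*s + s) * two
    have f4 : φ u = (φ x₁ + δ + 1) * S := by
      rw [f3]; simp [hδ, hSS]
    have : S = 0 := by linear_combination f4 * (-1) + f2 + S * hδ'
    rw [hSS] at this
    have : s = 0 := by simpa using this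
    have : 1 = t := aux_add_eq_zero (by rw [← hs, this])
    rw [← this]; simp

theorem aux_kasami (φ : K →+* K) (hφ : ∀ x, φ x = x → x = 0 ∨ x = 1) (x₁ x₂ c z₁ z₂ : K)
    (hz₁ : z₁ = φ x₁ + x₁) (hz₂ : z₂ = φ x₂ + x₂) (h₁ : z₁ ≠ 0) (h₂ : z₂ ≠ 0) (hc : c ≠ 0)
    (e₁ : c * (z₁ * φ z₁) = φ (x₁ ^ 2 + x₁)) (e₂ : c * (z₂ * φ z₂) = φ (x₂ ^ 2 + x₂)) :
    z₁ = z₂ := by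
  have two := aux_two (K := K)
  have key : ∀ x z : K, z = φ x + x → z ≠ 0 → c * (z * φ z) = φ (x ^ 2 + x) →
      φ c * φ (φ z) + c * z = φ z + 1 := by
    intro x z hz h e
    have hφz : φ z ≠ 0 := by simpa using h
    have e' := congrArg φ e
    have hz' := congrArg φ hz
    simp only [map_mul, map_add, map_pow] at e e' hz'
    apply mul_right_cancel₀ hφz
    linear_combination e + e' - (φ z + φ (φ x) + φ x + 1) * hz' - φ x * φ (φ x) * two
  have k₁ := key x₁ z₁ hz₁ h₁ e₁
  have k₂ := key x₂ z₂ hz₂ h₂ e₂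
  obtain ⟨e, he⟩ : ∃ e, e = c * (z₁ * φ z₂ + φ z₁ * z₂) := ⟨_, rfl⟩
  have hfix : φ (e + φ (x₁ + x₂)) = e + φ (x₁ + x₂) := by
    have e₁' := congrArg φ e₁
    have e₂' := congrArg φ e₂
    have hz₁' := congrArg φ hz₁
    have hz₂' := congrArg φ hz₂
    have he' := congrArg φ he
    simp only [map_mul, map_add, map_pow] at *
    apply aux_add_eq_zero
    have k : φ c * (φ (φ z₁) + φ (φ z₂)) + c * (z₁ + z₂) = φ z₁ + φ z₂ := by
      linear_combination k₁ + k₂ - two * (-1)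
    have k' : φ e + e = φ z₁ + φ z₂ := by
      have a₁ : φ z₁ * (φ c * φ (φ z₁) + c * z₁) = φ z₁ * (φ z₁ + 1) := by rw [k₁]
      have a₂ : φ z₂ * (φ c * φ (φ z₂) + c * z₂) = φ z₂ * (φ z₂ + 1) := by rw [k₂]
      linear_combination he + he' + (φ z₁ + φ z₂) * k - a₁ - a₂ + (φ z₁ * φ z₂) * two
        - (φ z₁ + φ z₂) * two
    linear_combination k' + hz₁' + hz₂' + (φ (φ x₁) + φ (φ x₂) + φ x₁ + φ x₂) * two
  rcases hφ _ hfix with h | h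
  · exact aux_core φ hφ x₁ x₂ c z₁ z₂ hz₁ hz₂ h₁ h₂ hc e₁ e₂ (by rw [← he, aux_add_eq_zero h])
  · refine aux_core φ hφ x₁ (x₂ + 1) c z₁ z₂ hz₁ ?_ h₁ h₂ hc e₁ ?_ ?_
    · rw [hz₂]; simp only [map_add, map_one]; linear_combination -two
    · rw [e₂]; congr 1; linear_combination -(x₂+1) * two
    · rw [← he]
      simp only [map_add, map_one] at *
      linear_combination h - (φ x₁ + φ x₂) * two

theorem aux_z (φ : K →+* K) (hφ : ∀ x, φ x = x → x = 0 ∨ x = 1) (x y : K)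
    (h : φ x + x = φ y + y) : y = x ∨ y = x + 1 := by
  have two := aux_two (K := K)
  have : φ (x + y) = x + y := by
    rw [map_add]; linear_combination h + (φ y - x) * two
  rcases hφ _ this with h | h
  · left; exact (aux_add_eq_zero h).symm
  · right; linear_combination h - x * two

/-- Reduction of APN-ness of a power map to the derivative in direction `1`. -/
theorem aux_APN (d : ℕ)
    (h : ∀ x y : K, (x + 1) ^ d + x ^ d = (y + 1) ^ d + y ^ d → y = x ∨ y = x + 1) :
    IsAPN (fun x : K => x ^ d) := by
  intro a b ha
  by_cases hne : {x : K | (x + a) ^ d + x ^ d = b}.Nonempty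
  · obtain ⟨x, hx⟩ := hne
    have hsub : {x : K | (x + a) ^ d + x ^ d = b} ⊆ {x, x + a} := by
      intro y hy
      simp only [Set.mem_ofPred_eq] at hx hy
      have hh : ∀ v : K, (v + a) ^ d + v ^ d = a ^ d * ((v / a + 1) ^ d + (v / a) ^ d) := by
        intro v
        rw [mul_add, ← mul_pow, ← mul_pow]
        congr 2 <;> field_simp
      rw [hh] at hx hy
      have := mul_left_cancel₀ (pow_ne_zero d ha) (hx.trans hy.symm)
      rcases h _ _ this with h | h
      · left; field_simp at h; exact h
      · right; field_simp at h; exact h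
    exact (Set.ncard_le_ncard hsub (Set.toFinite _)).trans ((Set.ncard_insert_le _ _).trans (by simp))
  · rw [Set.not_nonempty_iff_eq_empty] at hne
    simp only [hne, Set.ncard_empty]; omega

theorem aux_gold_deriv (φ : K →+* K) (hφ : ∀ x, φ x = x → x = 0 ∨ x = 1) (x y : K)
    (h : φ (x + 1) * (x + 1) + φ x * x = φ (y + 1) * (y + 1) + φ y * y) :
    y = x ∨ y = x + 1 := by
  apply aux_z φ hφ
  simp only [map_add, map_one] at h
  linear_combination h + (φ y * y - φ x * x) * aux_two (K := K)

theorem aux_kasami_deriv (φ : K →+* K) (hφ : ∀ x, φ x = x → x = 0 ∨ x = 1) (g : K → K)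
    (g0 : g 0 = 0) (g1 : g 1 = 1) (hg : ∀ x, g x * φ x = φ (φ x) * x) (x y : K)
    (h : g (x + 1) + g x = g (y + 1) + g y) :
    y = x ∨ y = x + 1 := by
  have two := aux_two (K := K)
  have h11 : (1 + 1 : K) = 0 := by linear_combination two
  have hz : ∀ x : K, φ x + x = 0 → x = 0 ∨ x = 1 := fun x h => hφ x (aux_add_eq_zero h)
  have hD : ∀ x : K, (x = 0 ∨ x = 1) → g (x + 1) + g x = 1 := by
    rintro x (rfl | rfl) <;> simp [h11, g0, g1]
  have hE : ∀ x : K, (g (x + 1) + g x + 1) * φ (x ^ 2 + x) =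
      (φ x + x) * φ (φ x + x) := by
    intro x
    have a := hg x
    have b := hg (x + 1)
    simp only [map_add, map_one, map_pow] at *
    linear_combination φ x * b + (φ x + 1) * a + (φ (φ x) * φ x * x + φ x) * two
  have hx0 : ∀ x : K, g (x + 1) + g x + 1 = 0 → x = 0 ∨ x = 1 := by
    intro x h
    have := hE x
    rw [h, zero_mul] at this
    rcases mul_eq_zero.1 this.symm with h | h
    · exact hz x h
    · exact hz x (by simpa only [map_eq_zero] using h)
  by_cases hb : g (x + 1) + g x + 1 = 0
  · have a := hx0 x hb
    have b := hx0 y (by rw [← h]; exact hb)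
    rcases a with rfl | rfl <;> rcases b with rfl | rfl <;> simp [h11]
  · have nx : φ x + x ≠ 0 := fun hh => hb (by rw [hD x (hz x hh), h11])
    have ny : φ y + y ≠ 0 := fun hh => hb (by rw [h, hD y (hz y hh), h11])
    apply aux_z φ hφ
    refine aux_kasami φ hφ x y (g (x + 1) + g x + 1)⁻¹ _ _ rfl rfl nx ny (inv_ne_zero hb) ?_ ?_
    · rw [← hE x, inv_mul_cancel_left₀ hb]
    · rw [← hE y, ← h, inv_mul_cancel_left₀ hb]

end Aux

theorem aux_fixed (n k : ℕ) (hn : 1 ≤ n) (hgcd : Nat.gcd k n = 1)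
    (x : GaloisField 2 n) (h : x ^ 2 ^ k = x) : x = 0 ∨ x = 1 := by
  by_cases hx : x = 0
  · exact Or.inl hx
  right
  have hcard : Nat.card (GaloisField 2 n) = 2 ^ n := GaloisField.card 2 n (by omega)
  have : Fintype (GaloisField 2 n) := Fintype.ofFinite _
  rw [Nat.card_eq_fintype_card] at hcard
  have h2 : x ^ (2 ^ n - 1) = 1 := by
    rw [← hcard]; exact FiniteField.pow_card_sub_one_eq_one x hx
  have h1 : x ^ (2 ^ k - 1) = 1 := by
    apply mul_right_cancel₀ hx
    rw [← pow_succ, Nat.sub_add_cancel Nat.one_le_two_pow, h, one_mul]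
  have h3 : x ^ (Nat.gcd (2 ^ k - 1) (2 ^ n - 1)) = 1 := pow_gcd_eq_one.2 ⟨h1, h2⟩
  rw [Nat.pow_sub_one_gcd_pow_sub_one, hgcd] at h3
  simpa using h3

/-- For `n, k ≥ 1` with `gcd(k,n) = 1`, the Gold function `x ↦ x^(2^k + 1)` and
the Kasami–Welch function `x ↦ x^(2^(2k) - 2^k + 1)` are APN on `F_{2^n}`. -/
theorem gold_and_kasami_are_APN (n k : ℕ) (hn : 1 ≤ n) (hk : 1 ≤ k)
    (hgcd : Nat.gcd k n = 1) :
    IsAPN (fun x : GaloisField 2 n => x ^ (2 ^ k + 1)) ∧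
    IsAPN (fun x : GaloisField 2 n => x ^ (2 ^ (2 * k) - 2 ^ k + 1)) := by
  have hφ : ∀ x : GaloisField 2 n, iterateFrobenius (GaloisField 2 n) 2 k x = x →
      x = 0 ∨ x = 1 := by
    intro x hx
    rw [iterateFrobenius_def] at hx
    exact aux_fixed n k hn hgcd x hx
  constructor
  · apply aux_APN
    intro x y h
    apply aux_gold_deriv _ hφ
    simpa only [iterateFrobenius_def, ← pow_succ] using h
  · apply aux_APN
    intro x y h
    refine aux_kasami_deriv _ hφ (fun x => x ^ (2 ^ (2 * k) - 2 ^ k + 1)) (by simp) (by simp) ?_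
      x y h
    intro x
    simp only [iterateFrobenius_def]
    rw [← pow_add, ← pow_mul, ← pow_succ]
    congr 1
    have : 2 ^ k ≤ 2 ^ (2 * k) := Nat.pow_le_pow_right (by norm_num) (by omega)
    have h2 : 2 ^ (2 * k) = 2 ^ k * 2 ^ k := by rw [two_mul, pow_add]
    omega
end
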